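/- Let K_x ⊂ ℝ^n and K_yz ⊂ ℝ^{m+p} be compact, and assume K = K_x × K_yz ⊂ ℝ^{n+m+p} has nonempty interior. Suppose there exists a scalar N ∈ ℝ such that N − ‖X‖² ∈ Q(g). If f ∈ ℝ[X,Y] + ℝ[Y,Z] and f(x,y,z) > 0 for all (x,y,z) ∈ K, then f ∈ Σ²_xy + Q(g) + P(h), i.e. f = κ + σ + ψ for some sum of squares κ ∈ Σ²_xy, some σ ∈ Q(g) and some ψ ∈ P(h). -/

import Mathlib

open MvPolynomial

/-- A polynomial is a sum of squares. -/
def IsSOS {ι : Type*} (q : MvPolynomial ι ℝ) : Prop :=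
  ∃ (k : ℕ) (s : Fin k → MvPolynomial ι ℝ), q = ∑ i, (s i) ^ 2

/-- Membership in the preordering generated by a finite family `g`:
`σ = Σ_{J ⊆ I} σ_J ∏_{j ∈ J} g_j` with each `σ_J` a sum of squares. -/
def InPreordering {ι κ : Type*} [Fintype κ] [DecidableEq κ]
    (g : κ → MvPolynomial ι ℝ) (σ : MvPolynomial ι ℝ) : Prop :=
  ∃ c : Finset κ → MvPolynomial ι ℝ,
    (∀ J, IsSOS (c J)) ∧ σ = ∑ J : Finset κ, c J * ∏ j ∈ J, g j

/-- Membership in the quadratic module generated by a finite family `g`: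
`σ = σ₀ + Σ_j σ_j g_j` with `σ₀` and each `σ_j` sums of squares. -/
def InQuadraticModule {ι κ : Type*} [Fintype κ]
    (g : κ → MvPolynomial ι ℝ) (σ : MvPolynomial ι ℝ) : Prop :=
  ∃ (c₀ : MvPolynomial ι ℝ) (c : κ → MvPolynomial ι ℝ),
    IsSOS c₀ ∧ (∀ j, IsSOS (c j)) ∧ σ = c₀ + ∑ j, c j * g j

namespace CP

/-- intermediate value property for polynomials -/
def IVP (R : Type*) [Field R] [LinearOrder R] [IsStrictOrderedRing R] : Prop :=
  ∀ (p : Polynomial R) (a b : R), a ≤ b → p.eval a ≤ 0 → 0 ≤ p.eval b →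
    ∃ c, a ≤ c ∧ c ≤ b ∧ p.eval c = 0

section
variable {R : Type*} [Field R] [LinearOrder R] [IsStrictOrderedRing R]

lemma IVP.of_mul (h : IVP R) (p : Polynomial R) {a b : R} (hab : a ≤ b)
    (hm : p.eval a * p.eval b ≤ 0) : ∃ c, a ≤ c ∧ c ≤ b ∧ p.eval c = 0 := by
  rcases le_total (p.eval a) 0 with h1 | h1 <;> rcases le_total (p.eval b) 0 with h2 | h2
  · have h3 : p.eval a * p.eval b = 0 := le_antisymm hm (mul_nonneg_of_nonpos_of_nonpos h1 h2)
    rcases mul_eq_zero.1 h3 with h4 | h4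
    · exact ⟨a, le_rfl, hab, h4⟩
    · exact ⟨b, hab, le_rfl, h4⟩
  · exact h p a b hab h1 h2
  · obtain ⟨c, h3, h4, h5⟩ := h (-p) a b hab (by simpa using h1) (by simpa using h2)
    exact ⟨c, h3, h4, by simpa using h5⟩
  · have h3 : p.eval a * p.eval b = 0 := le_antisymm hm (mul_nonneg h1 h2)
    rcases mul_eq_zero.1 h3 with h4 | h4
    · exact ⟨a, le_rfl, hab, h4⟩
    · exact ⟨b, hab, le_rfl, h4⟩

lemma IVP.mulpos (h : IVP R) (p : Polynomial R) {a b : R} (hab : a ≤ b)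
    (hr : ∀ c, a ≤ c → c ≤ b → p.eval c ≠ 0) : 0 < p.eval a * p.eval b := by
  by_contra hc
  obtain ⟨c, h1, h2, h3⟩ := h.of_mul p hab (not_lt.1 hc)
  exact hr c h1 h2 h3

/-- Rolle with no interior roots -/
lemma IVP.rolle0 (h : IVP R) (p : Polynomial R) (hp : p ≠ 0) {a b : R} (hab : a < b)
    (ha : p.eval a = 0) (hb : p.eval b = 0) (hr : ∀ c, a < c → c < b → p.eval c ≠ 0) :
    ∃ c, a < c ∧ c < b ∧ p.derivative.eval c = 0 := by
  obtain ⟨q, hq, hqa⟩ := Polynomial.exists_eq_pow_rootMultiplicity_mul_and_not_dvd p hp a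
  set m := p.rootMultiplicity a with hm
  have hm0 : m ≠ 0 := by
    have := (Polynomial.rootMultiplicity_pos hp).2 ha
    omega
  have hq0 : q ≠ 0 := by rintro rfl; simp at hqa
  have hqb : q.eval b = 0 := by
    have : p.eval b = (b - a) ^ m * q.eval b := by rw [hq]; simp
    rw [hb] at this
    rcases mul_eq_zero.1 this.symm with h1 | h1
    · exact absurd (pow_eq_zero_iff hm0 |>.1 h1) (sub_pos.2 hab).ne'
    · exact h1
  obtain ⟨g, hg, hgb⟩ := Polynomial.exists_eq_pow_rootMultiplicity_mul_and_not_dvd q hq0 b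
  set k := q.rootMultiplicity b with hk
  have hk0 : k ≠ 0 := by
    have := (Polynomial.rootMultiplicity_pos hq0).2 hqb
    omega
  have hgb' : g.eval b ≠ 0 := fun h1 => hgb (Polynomial.dvd_iff_isRoot.2 h1)
  have hga' : g.eval a ≠ 0 := by
    intro h1
    apply hqa
    rw [Polynomial.dvd_iff_isRoot, Polynomial.IsRoot, hg]
    simp [h1]
  have hgpos : 0 < g.eval a * g.eval b := by
    apply h.mulpos g hab.le
    intro c h1 h2 h3
    rcases h1.eq_or_lt with rfl | h1
    · exact hga' h3
    rcases h2.eq_or_lt with rfl | h2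
    · exact hgb' h3
    apply hr c h1 h2
    rw [hq, hg]; simp [h3]
  obtain ⟨m', hm'⟩ := Nat.exists_eq_succ_of_ne_zero hm0
  obtain ⟨k', hk'⟩ := Nat.exists_eq_succ_of_ne_zero hk0
  set H : Polynomial R := Polynomial.C (m : R) * (Polynomial.X - Polynomial.C b) * g
    + Polynomial.C (k : R) * (Polynomial.X - Polynomial.C a) * g
    + (Polynomial.X - Polynomial.C a) * (Polynomial.X - Polynomial.C b) * Polynomial.derivative g with hH
  have hder : p.derivative = (Polynomial.X - Polynomial.C a) ^ m' * (Polynomial.X - Polynomial.C b) ^ k' * H := by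
    rw [hq, hg, hH, hm', hk']
    simp only [Polynomial.derivative_mul, Polynomial.derivative_X_sub_C_pow]
    push_cast
    simp only [Nat.succ_eq_add_one, Nat.add_sub_cancel, Polynomial.C_add, Polynomial.C_1, pow_succ]
    ring
  have hHa : H.eval a = m * (a - b) * g.eval a := by simp [hH]
  have hHb : H.eval b = k * (b - a) * g.eval b := by simp [hH]
  have hmp : (0 : R) < m := by exact_mod_cast Nat.pos_of_ne_zero hm0
  have hkp : (0 : R) < k := by exact_mod_cast Nat.pos_of_ne_zero hk0
  have hbapos := sub_pos.2 hab
  have hneg : H.eval a * H.eval b < 0 := by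
    rw [hHa, hHb]
    have : (m * (a - b) * g.eval a) * (k * (b - a) * g.eval b)
      = - ((m : R) * k * ((b - a) * (b - a)) * (g.eval a * g.eval b)) := by ring
    rw [this, neg_lt_zero]
    positivity
  obtain ⟨c, h1, h2, h3⟩ := h.of_mul H hab.le hneg.le
  refine ⟨c, lt_of_le_of_ne h1 ?_, lt_of_le_of_ne h2 ?_, by rw [hder]; simp [h3]⟩
  · rintro rfl; rw [h3] at hneg; simp at hneg
  · rintro rfl; rw [h3] at hneg; simp at hneg

lemma IVP.rolle (h : IVP R) (p : Polynomial R) {a b : R} (hab : a < b)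
    (ha : p.eval a = 0) (hb : p.eval b = 0) :
    ∃ c, a < c ∧ c < b ∧ p.derivative.eval c = 0 := by
  classical
  by_cases hp : p = 0
  · subst hp
    obtain ⟨c, h1, h2⟩ := exists_between hab
    exact ⟨c, h1, h2, by simp⟩
  set s := p.roots.toFinset.filter (fun c => a < c) with hs
  have hbs : b ∈ s := by simp [hs, hp, hb, hab]
  have hne : s.Nonempty := ⟨b, hbs⟩
  have hmin := s.min'_mem hne
  set b' := s.min' hne with hb'
  have hb'b : b' ≤ b := s.min'_le b hbs
  have h1 : p.eval b' = 0 ∧ a < b' := by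
    simpa [hs, hp] using hmin
  obtain ⟨c, h2, h3, h4⟩ := h.rolle0 p hp h1.2 ha h1.1 (by
    intro c hc1 hc2 hc3
    have : c ∈ s := by simp [hs, hp, hc3, hc1]
    exact absurd (s.min'_le c this) (not_le.2 hc2))
  exact ⟨c, h2, h3.trans_le hb'b, h4⟩

lemma IVP.mvt (h : IVP R) (p : Polynomial R) {a b : R} (hab : a < b) :
    ∃ c, a < c ∧ c < b ∧ p.eval b - p.eval a = p.derivative.eval c * (b - a) := by
  have hba := (sub_pos.2 hab).ne'
  set s := (p.eval b - p.eval a) / (b - a) with hs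
  obtain ⟨c, h1, h2, h3⟩ := h.rolle (p - Polynomial.C (p.eval a) -
    Polynomial.C s * (Polynomial.X - Polynomial.C a)) hab (by simp) (by simp [hs]; field_simp; ring)
  refine ⟨c, h1, h2, ?_⟩
  simp at h3
  have : p.derivative.eval c = s := by linear_combination h3
  rw [this, hs]; field_simp
end
end CP

namespace CP
section
variable {R : Type*} [Field R] [LinearOrder R] [IsStrictOrderedRing R]

lemma IVP.same_sign (h : IVP R) (r : Polynomial R) {l u x y : R}
    (hr : ∀ c, l < c → c < u → r.eval c ≠ 0) (hx : l < x) (hx' : x < u) (hy : l < y) (hy' : y < u) :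
    0 < r.eval x ↔ 0 < r.eval y := by
  have key : 0 < r.eval x * r.eval y := by
    rcases le_total x y with hxy | hxy
    · exact h.mulpos r hxy (fun c h1 h2 => hr c (hx.trans_le h1) (h2.trans_lt hy'))
    · rw [mul_comm]
      exact h.mulpos r hxy (fun c h1 h2 => hr c (hy.trans_le h1) (h2.trans_lt hx'))
  constructor
  · intro h1; exact (pos_iff_pos_of_mul_pos key).1 h1
  · intro h1; exact (pos_iff_pos_of_mul_pos key).2 h1

lemma IVP.flip (h : IVP R) (q : Polynomial R) {lo hi l u α : R}
    (hr : ∀ c, lo < c → c < hi → q.derivative.eval c ≠ 0) (h1 : lo ≤ l) (h2 : l < α) (h3 : α < u)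
    (h4 : u ≤ hi) (hα : q.eval α = 0) : q.eval l * q.eval u < 0 := by
  obtain ⟨c, hc1, hc2, hc3⟩ := h.mvt q h2
  obtain ⟨d, hd1, hd2, hd3⟩ := h.mvt q h3
  rw [hα] at hc3 hd3
  have e1 : q.eval l = - (q.derivative.eval c * (α - l)) := by linear_combination -hc3
  have e2 : q.eval u = q.derivative.eval d * (u - α) := by linear_combination hd3
  have key : 0 < q.derivative.eval c * q.derivative.eval d :=
    h.mulpos _ (hc2.trans hd1).le (fun x hx1 hx2 => hr x (h1.trans_lt (hc1.trans_le hx1))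
      ((hx2.trans_lt hd2).trans_le h4))
  rw [e1, e2]
  have := mul_pos key (mul_pos (sub_pos.2 h2) (sub_pos.2 h3))
  linarith

lemma IVP.uniq (h : IVP R) (q : Polynomial R) {lo hi x y : R}
    (hr : ∀ c, lo < c → c < hi → q.derivative.eval c ≠ 0) (hx : lo < x) (hx' : x < hi)
    (hy : lo < y) (hy' : y < hi) (h1 : q.eval x = 0) (h2 : q.eval y = 0) : x = y := by
  rcases lt_trichotomy x y with h3 | h3 | h3
  · obtain ⟨c, hc1, hc2, hc3⟩ := h.rolle q h3 h1 h2
    exact absurd hc3 (hr c (hx.trans hc1) (hc2.trans hy'))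
  · exact h3
  · obtain ⟨c, hc1, hc2, hc3⟩ := h.rolle q h3 h2 h1
    exact absurd hc3 (hr c (hy.trans hc1) (hc2.trans hx'))

/-- root bound -/
lemma root_bound (q : Polynomial R) (hq : q.Monic) (α : R) (hα : q.eval α = 0) :
    |α| < 2 + ∑ i ∈ Finset.range q.natDegree, (1 + q.coeff i ^ 2) := by
  by_contra hc
  rw [not_lt] at hc
  set n := q.natDegree with hn
  have hS : 0 ≤ ∑ i ∈ Finset.range n, (1 + q.coeff i ^ 2) := Finset.sum_nonneg (fun i _ => by positivity)
  have h1 : 1 ≤ |α| := by linarith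
  have h0 : 0 < |α| := by linarith
  have e : α ^ n = - ∑ i ∈ Finset.range n, q.coeff i * α ^ i := by
    rw [Polynomial.eval_eq_sum_range, Finset.sum_range_succ, ← hn] at hα
    have : q.coeff n = 1 := hq
    rw [this] at hα
    linear_combination hα
  have hn0 : n ≠ 0 := by
    intro h; rw [h] at e; simp at e
  obtain ⟨m, hm⟩ := Nat.exists_eq_succ_of_ne_zero hn0
  have e2 : |α| ^ n ≤ (∑ i ∈ Finset.range n, (1 + q.coeff i ^ 2)) * |α| ^ m := by
    rw [← abs_pow, e, abs_neg, Finset.sum_mul]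
    refine (Finset.abs_sum_le_sum_abs _ _).trans (Finset.sum_le_sum ?_)
    intro i hi
    rw [abs_mul, abs_pow]
    have hi' : i ≤ m := by have := Finset.mem_range.1 hi; omega
    apply mul_le_mul _ (pow_le_pow_right₀ h1 hi') (by positivity) (by positivity)
    rw [abs_le]; constructor <;> nlinarith [sq_nonneg (q.coeff i - 1), sq_nonneg (q.coeff i + 1)]
  have e3 : |α| ^ n = |α| * |α| ^ m := by rw [hm, pow_succ, mul_comm]
  rw [e3] at e2
  have := le_of_mul_le_mul_right e2 (by positivity)
  linarith
end

section
variable {k A B : Type*} [CommRing k]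
  [Field A] [LinearOrder A] [IsStrictOrderedRing A]
  [Field B] [LinearOrder B] [IsStrictOrderedRing B]

lemma cmp_lt (i : k →+* A) (j : k →+* B) (hs : ∀ c, 0 < i c ↔ 0 < j c) (c d : k) :
    i c < i d ↔ j c < j d := by
  have := hs (d - c)
  simpa using this

lemma cmp_le (i : k →+* A) (j : k →+* B) (hs : ∀ c, 0 < i c ↔ 0 < j c) (c d : k) :
    i c ≤ i d ↔ j c ≤ j d := by
  rw [← not_lt, ← not_lt, cmp_lt i j hs]

lemma inj_of_inv (i : k →+* A) (hinv : ∀ c : k, c ≠ 0 → ∃ d, c * d = 1) : Function.Injective i := by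
  rw [injective_iff_map_eq_zero]
  intro c hc
  by_contra h
  obtain ⟨d, hd⟩ := hinv c h
  have := congrArg i hd
  simp [hc] at this

lemma isolate (i : k →+* A) (j : k →+* B) (hs : ∀ c, 0 < i c ↔ 0 < j c)
    (hi : Function.Injective i) (hj : Function.Injective j)
    (f : Polynomial k) (hf : f ≠ 0)
    (hfA : ∀ x, f.eval₂ i x = 0 → ∃ c, i c = x) (hfB : ∀ x, f.eval₂ j x = 0 → ∃ c, j c = x)
    (α : A) (hα : ∀ c, i c ≠ α) (lo0 hi0 : k) (h1 : i lo0 < α) (h2 : α < i hi0) :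
    ∃ lo hi, i lo0 ≤ i lo ∧ i lo < α ∧ α < i hi ∧ i hi ≤ i hi0 ∧
      (∀ x, i lo < x → x < i hi → f.eval₂ i x ≠ 0) ∧
      (∀ y, j lo < y → y < j hi → f.eval₂ j y ≠ 0) := by
  classical
  have hfi : f.map i ≠ 0 := (Polynomial.map_ne_zero_iff hi).2 hf
  set s := insert (i lo0) ((f.map i).roots.toFinset.filter (fun c => c < α)) with hsdef
  set t := insert (i hi0) ((f.map i).roots.toFinset.filter (fun c => α < c)) with htdef
  have hsne : s.Nonempty := ⟨i lo0, by simp [hsdef]⟩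
  have htne : t.Nonempty := ⟨i hi0, by simp [htdef]⟩
  have hsm := Finset.mem_insert.1 (s.max'_mem hsne)
  have htm := Finset.mem_insert.1 (t.min'_mem htne)
  have a1 : (∃ c, i c = s.max' hsne) ∧ s.max' hsne < α := by
    rcases hsm with h | h
    · rw [h]; exact ⟨⟨_, rfl⟩, h1⟩
    · have h' := (Finset.mem_filter.1 h).2
      simp [hfi, Polynomial.eval_map] at h
      exact ⟨hfA _ h.1, h'⟩
  have a2 : (∃ c, i c = t.min' htne) ∧ α < t.min' htne := by
    rcases htm with h | h
    · rw [h]; exact ⟨⟨_, rfl⟩, h2⟩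
    · have h' := (Finset.mem_filter.1 h).2
      simp [hfi, Polynomial.eval_map] at h
      exact ⟨hfA _ h.1, h'⟩
  obtain ⟨⟨lo, hlo⟩, hlo'⟩ := a1
  obtain ⟨⟨hi', hhi⟩, hhi'⟩ := a2
  have key : ∀ x, i lo < x → x < i hi' → f.eval₂ i x ≠ 0 := by
    intro x hx1 hx2 hx3
    obtain ⟨c, rfl⟩ := hfA x hx3
    rcases lt_or_gt_of_ne (hα c) with h | h
    · have : i c ∈ s := by simp [hsdef, hfi, Polynomial.eval_map, hx3, h]
      have := s.le_max' _ this
      rw [← hlo] at this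
      exact absurd this (not_le.2 hx1)
    · have : i c ∈ t := by simp [htdef, hfi, Polynomial.eval_map, hx3, h]
      have := t.min'_le _ this
      rw [← hhi] at this
      exact absurd this (not_le.2 hx2)
  refine ⟨lo, hi', ?_, by rw [hlo]; exact hlo', by rw [hhi]; exact hhi', ?_, key, ?_⟩
  · rw [hlo]; exact s.le_max' _ (by simp [hsdef])
  · rw [hhi]; exact t.min'_le _ (by simp [htdef])
  · intro y hy1 hy2 hy3
    obtain ⟨c, rfl⟩ := hfB y hy3
    apply key (i c) ((cmp_lt i j hs _ _).2 hy1) ((cmp_lt i j hs _ _).2 hy2)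
    rw [Polynomial.eval₂_at_apply] at hy3 ⊢
    have : f.eval c = 0 := hj (by rw [hy3, map_zero])
    rw [this, map_zero]

lemma ext_step (hA : IVP A) (hB : IVP B) (i : k →+* A) (j : k →+* B)
    (hs : ∀ c, 0 < i c ↔ 0 < j c) (hinv : ∀ c : k, c ≠ 0 → ∃ d, c * d = 1)
    (p : Polynomial k) (hp : p.Monic)
    (hmA : ∀ f : Polynomial k, f ≠ 0 → f.natDegree < p.natDegree → ∀ x, f.eval₂ i x = 0 → ∃ c, i c = x)
    (hmB : ∀ f : Polynomial k, f ≠ 0 → f.natDegree < p.natDegree → ∀ x, f.eval₂ j x = 0 → ∃ c, j c = x)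
    (α : A) (hα : ∀ c, i c ≠ α) (hpα : p.eval₂ i α = 0) :
    ∃ β, ∀ f : Polynomial k, 0 < f.eval₂ i α ↔ 0 < f.eval₂ j β := by
  have hi := inj_of_inv i hinv
  have hj := inj_of_inv j hinv
  have : Nontrivial k := RingHom.domain_nontrivial i
  have hneg : ∀ c, i c < 0 ↔ j c < 0 := by
    intro c; have := hs (-c); simpa using this
  have hn0 : p.natDegree ≠ 0 := by
    intro h
    rw [hp.natDegree_eq_zero] at h
    simp [h] at hpα
  have hd0 : p.derivative ≠ 0 := by
    intro h
    have h1 : (p.map i).derivative = 0 := by rw [Polynomial.derivative_map, h]; simp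
    have h2 := Polynomial.derivative_eq_zero.1 h1
    rw [hp.natDegree_map] at h2
    exact hn0 h2
  have hdlt : p.derivative.natDegree < p.natDegree := Polynomial.natDegree_derivative_lt hn0
  set M : k := 2 + ∑ l ∈ Finset.range p.natDegree, (1 + p.coeff l ^ 2) with hM
  have hbd : |α| < i M := by
    have := root_bound (p.map i) (hp.map i) α (by rw [Polynomial.eval_map, hpα])
    rw [hp.natDegree_map] at this
    simpa [hM, map_ofNat] using this
  rw [abs_lt] at hbd
  obtain ⟨lo, hi', -, hlo, hhi, -, hrA, hrB⟩ := isolate i j hs hi hj p.derivative hd0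
    (hmA _ hd0 hdlt) (hmB _ hd0 hdlt) α hα (-M) M (by simpa using hbd.1) hbd.2
  have hrA' : ∀ c, i lo < c → c < i hi' → (p.map i).derivative.eval c ≠ 0 := by
    intro c h1 h2; rw [Polynomial.derivative_map, Polynomial.eval_map]; exact hrA c h1 h2
  have hrB' : ∀ c, j lo < c → c < j hi' → (p.map j).derivative.eval c ≠ 0 := by
    intro c h1 h2; rw [Polynomial.derivative_map, Polynomial.eval_map]; exact hrB c h1 h2
  -- a root of p in every refined interval
  have hroot : ∀ l u, i lo ≤ i l → i l < α → α < i u → i u ≤ i hi' →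
      ∃ β, j l < β ∧ β < j u ∧ p.eval₂ j β = 0 := by
    intro l u h1 h2 h3 h4
    have h5 := hA.flip (p.map i) hrA' h1 h2 h3 h4 (by rw [Polynomial.eval_map, hpα])
    rw [Polynomial.eval_map, Polynomial.eval_map, Polynomial.eval₂_at_apply,
      Polynomial.eval₂_at_apply, ← map_mul, hneg, map_mul, ← Polynomial.eval₂_at_apply,
      ← Polynomial.eval₂_at_apply, ← Polynomial.eval_map, ← Polynomial.eval_map] at h5
    have hlu : j l < j u := (cmp_lt i j hs _ _).1 (h2.trans h3)
    obtain ⟨β, h6, h7, h8⟩ := hB.of_mul _ hlu.le h5.le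
    refine ⟨β, lt_of_le_of_ne h6 ?_, lt_of_le_of_ne h7 ?_, by rw [← Polynomial.eval_map, h8]⟩
    · rintro rfl; rw [h8] at h5; simp at h5
    · rintro rfl; rw [h8] at h5; simp at h5
  obtain ⟨β, hβ1, hβ2, hβ3⟩ := hroot lo hi' le_rfl hlo hhi le_rfl
  refine ⟨β, fun f => ?_⟩
  have hfA : f.eval₂ i α = (f %ₘ p).eval₂ i α := by
    conv_lhs => rw [← Polynomial.modByMonic_add_div f p]
    simp [Polynomial.eval₂_add, Polynomial.eval₂_mul, hpα]
  have hfB : f.eval₂ j β = (f %ₘ p).eval₂ j β := by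
    conv_lhs => rw [← Polynomial.modByMonic_add_div f p]
    simp [Polynomial.eval₂_add, Polynomial.eval₂_mul, hβ3]
  rw [hfA, hfB]
  set r := f %ₘ p with hr
  by_cases hr0 : r = 0
  · simp [hr0]
  have hrd : r.natDegree < p.natDegree := Polynomial.natDegree_modByMonic_lt f hp (by rintro rfl; simp at hn0)
  obtain ⟨l, u, h1, h2, h3, h4, h5, h6⟩ := isolate i j hs hi hj r hr0 (hmA _ hr0 hrd) (hmB _ hr0 hrd) α hα
    lo hi' hlo hhi
  obtain ⟨β', hβ'1, hβ'2, hβ'3⟩ := hroot l u h1 h2 h3 h4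
  have hbb : β' = β := hB.uniq (p.map j) hrB' (((cmp_le i j hs _ _).1 h1).trans_lt hβ'1)
    (hβ'2.trans_le ((cmp_le i j hs _ _).1 h4)) hβ1 hβ2 (by rw [Polynomial.eval_map, hβ'3])
    (by rw [Polynomial.eval_map, hβ3])
  subst hbb
  obtain ⟨d, hd⟩ := hinv 2 (by
    intro h; have := congrArg i h; simp [map_ofNat] at this)
  have hdi : i d = 1 / 2 := by
    have := congrArg i hd
    rw [map_mul, map_ofNat, map_one] at this; field_simp; linear_combination this
  have hdj : j d = 1 / 2 := by
    have := congrArg j hd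
    rw [map_mul, map_ofNat, map_one] at this; field_simp; linear_combination this
  have hju : j l < j u := hβ'1.trans hβ'2
  have s1 := hA.same_sign (r.map i) (l := i l) (u := i u) (x := α) (y := i ((l + u) * d))
    (by intro c c1 c2; rw [Polynomial.eval_map]; exact h5 c c1 c2) h2 h3
    (by rw [map_mul, map_add, hdi]; linarith) (by rw [map_mul, map_add, hdi]; linarith)
  have s2 := hB.same_sign (r.map j) (l := j l) (u := j u) (x := β') (y := j ((l + u) * d))
    (by intro c c1 c2; rw [Polynomial.eval_map]; exact h6 c c1 c2) hβ'1 hβ'2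
    (by rw [map_mul, map_add, hdj]; linarith) (by rw [map_mul, map_add, hdj]; linarith)
  simp only [Polynomial.eval_map] at s1 s2
  rw [s1, s2, Polynomial.eval₂_at_apply, Polynomial.eval₂_at_apply, hs]
end
end CP

namespace CP
section
variable {A B : Type*}
  [Field A] [LinearOrder A] [IsStrictOrderedRing A]
  [Field B] [LinearOrder B] [IsStrictOrderedRing B]

/-- sign-compatible subrings of a product -/
def Good (S : Subring (A × B)) : Prop := ∀ s ∈ S, 0 < s.1 ↔ 0 < s.2

def MaxGood (S : Subring (A × B)) : Prop := Good S ∧ ∀ S', S ≤ S' → Good S' → S' ≤ S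

lemma exists_maxGood (S₀ : Subring (A × B)) (h : Good S₀) : ∃ S, S₀ ≤ S ∧ MaxGood S := by
  obtain ⟨m, h1, h2⟩ := zorn_le_nonempty₀ {S : Subring (A × B) | Good S} (by
    intro c hc hchain y hy
    have hd : DirectedOn (· ≤ ·) c := hchain.directedOn
    refine ⟨sSup c, ?_, fun z hz => le_sSup hz⟩
    intro s hs
    rw [Subring.mem_sSup_of_directedOn ⟨y, hy⟩ hd] at hs
    obtain ⟨t, ht, hst⟩ := hs
    exact hc ht s hst) S₀ h
  exact ⟨m, h1, h2.1, fun S' h3 h4 => h2.2 h4 h3⟩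

/-- first projection -/
def ii (S : Subring (A × B)) : S →+* A := (RingHom.fst A B).comp S.subtype
/-- second projection -/
def jj (S : Subring (A × B)) : S →+* B := (RingHom.snd A B).comp S.subtype

lemma MaxGood.mem_of {S : Subring (A × B)} (hS : MaxGood S) (α : A) (β : B)
    (h : ∀ f : Polynomial S, 0 < f.eval₂ (ii S) α ↔ 0 < f.eval₂ (jj S) β) : (α, β) ∈ S := by
  set φ : Polynomial S →+* A × B := Polynomial.eval₂RingHom S.subtype (α, β) with hφ
  have h1 : S ≤ φ.range := by
    intro s hs
    refine ⟨Polynomial.C ⟨s, hs⟩, by simp [hφ]⟩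
  have h2 : Good φ.range := by
    rintro s ⟨f, rfl⟩
    have e1 : (φ f).1 = f.eval₂ (ii S) α := Polynomial.hom_eval₂ f S.subtype (RingHom.fst A B) (α, β)
    have e2 : (φ f).2 = f.eval₂ (jj S) β := Polynomial.hom_eval₂ f S.subtype (RingHom.snd A B) (α, β)
    rw [e1, e2, h]
  exact hS.2 _ h1 h2 ⟨Polynomial.X, by simp [hφ]⟩

lemma Good.sgn {S : Subring (A × B)} (hS : Good S) (c : S) : 0 < ii S c ↔ 0 < jj S c := hS c.1 c.2

lemma Good.zero1 {S : Subring (A × B)} (hS : Good S) (c : S) (h : ii S c = 0) : c = 0 := by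
  have h1 := hS.sgn c
  have h2 := hS.sgn (-c)
  simp [h] at h1 h2
  have h3 : jj S c = 0 := le_antisymm h1 h2
  exact Subtype.ext (Prod.ext h h3)

lemma Good.zero2 {S : Subring (A × B)} (hS : Good S) (c : S) (h : jj S c = 0) : c = 0 := by
  have h1 := hS.sgn c
  have h2 := hS.sgn (-c)
  simp [h] at h1 h2
  have h3 : ii S c = 0 := le_antisymm h1 h2
  exact Subtype.ext (Prod.ext h3 h)

lemma inv_sign {k : Type*} [CommRing k] (i : k →+* A) (c : k) (hc : i c ≠ 0) (f : Polynomial k) :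
    0 < f.eval₂ i (i c)⁻¹ ↔ 0 < i (f.reverse.eval c * c ^ f.natDegree) := by
  have : Invertible ((i c)⁻¹) := invertibleOfNonzero (inv_ne_zero hc)
  have h := Polynomial.eval₂_reverse_mul_pow i ((i c)⁻¹) f
  have h2 : ⅟((i c)⁻¹) = i c := by simp
  rw [h2, Polynomial.eval₂_at_apply] at h
  rw [← h, map_mul, map_pow]
  have h3 : i (f.reverse.eval c) * i c ^ f.natDegree =
    (i (f.reverse.eval c) * (i c)⁻¹ ^ f.natDegree) * (i c ^ f.natDegree) ^ 2 := by
    have : i c ^ f.natDegree ≠ 0 := pow_ne_zero _ hc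
    rw [inv_pow]; field_simp
  rw [h3]
  have h4 : 0 < (i c ^ f.natDegree) ^ 2 := by positivity
  exact (mul_pos_iff_of_pos_right h4).symm

lemma MaxGood.inv {S : Subring (A × B)} (hS : MaxGood S) (c : S) (hc : c ≠ 0) : ∃ d, c * d = 1 := by
  have h1 : ii S c ≠ 0 := fun h => hc (hS.1.zero1 c h)
  have h2 : jj S c ≠ 0 := fun h => hc (hS.1.zero2 c h)
  have := hS.mem_of (ii S c)⁻¹ (jj S c)⁻¹ (by
    intro f
    rw [inv_sign _ c h1, inv_sign _ c h2, hS.1.sgn])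
  refine ⟨⟨_, this⟩, Subtype.ext (Prod.ext ?_ ?_)⟩
  · exact mul_inv_cancel₀ h1
  · exact mul_inv_cancel₀ h2

lemma MaxGood.alg {S : Subring (A × B)} (hS : MaxGood S) (hA : IVP A) (hB : IVP B) :
    ∀ (n : ℕ) (f : Polynomial S), f ≠ 0 → f.natDegree < n →
      (∀ x, f.eval₂ (ii S) x = 0 → ∃ c, ii S c = x) ∧
      (∀ x, f.eval₂ (jj S) x = 0 → ∃ c, jj S c = x) := by
  intro n
  induction n with
  | zero => intro f _ h; omega
  | succ n ih =>
    intro f hf hfn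
    obtain ⟨d, hd⟩ := hS.inv f.leadingCoeff (by simpa using hf)
    have hnt : Nontrivial S := RingHom.domain_nontrivial (ii S)
    have hmon : (Polynomial.C d * f).Monic := Polynomial.monic_C_mul_of_mul_leadingCoeff_eq_one (by rw [mul_comm, hd])
    have hdeg : (Polynomial.C d * f).natDegree ≤ n := (Polynomial.natDegree_C_mul_le d f).trans (by omega)
    have hmA := fun (g : Polynomial S) hg (hgn : g.natDegree < (Polynomial.C d * f).natDegree) => (ih g hg (hgn.trans_le hdeg)).1
    have hmB := fun (g : Polynomial S) hg (hgn : g.natDegree < (Polynomial.C d * f).natDegree) => (ih g hg (hgn.trans_le hdeg)).2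
    constructor
    · intro x hx
      by_contra hc
      push Not at hc
      obtain ⟨β, hβ⟩ := ext_step hA hB (ii S) (jj S) hS.1.sgn hS.inv _ hmon hmA hmB x hc
        (by simp [Polynomial.eval₂_mul, hx])
      exact hc ⟨_, hS.mem_of x β hβ⟩ rfl
    · intro x hx
      by_contra hc
      push Not at hc
      obtain ⟨β, hβ⟩ := ext_step hB hA (jj S) (ii S) (fun c => (hS.1.sgn c).symm) hS.inv _ hmon hmB hmA x hc
        (by simp [Polynomial.eval₂_mul, hx])
      exact hc ⟨_, hS.mem_of β x (fun f => (hβ f).symm)⟩ rfl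

/-- an IVP field is relatively algebraically closed in an IVP extension -/
lemma IVP.rel_closed (hA : IVP A) (hB : IVP B) (e : B →+* A) (he : ∀ b, 0 < e b ↔ 0 < b)
    (f : Polynomial B) (hf : f ≠ 0) (x : A) (hx : f.eval₂ e x = 0) : ∃ b, e b = x := by
  set φ : B →+* A × B := RingHom.prod e (RingHom.id B) with hφ
  obtain ⟨S, h1, h2⟩ := exists_maxGood φ.range (by rintro s ⟨b, rfl⟩; simp [hφ, he])
  set ψ : B →+* S := φ.codRestrict S (fun b => h1 ⟨b, rfl⟩) with hψ
  have hinj : Function.Injective ψ := ψ.injective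
  obtain ⟨c, hc⟩ := (h2.alg hA hB _ (f.map ψ) ((Polynomial.map_ne_zero_iff hinj).2 hf) (Nat.lt_succ_self _)).1 x (by
    rw [Polynomial.eval₂_map]; exact hx)
  refine ⟨jj S c, ?_⟩
  have h3 : c - ψ (jj S c) = 0 := by
    apply h2.1.zero2
    rw [map_sub, sub_eq_zero]; rfl
  have h4 := congrArg (ii S) h3
  rw [map_sub, map_zero, sub_eq_zero, hc] at h4
  rw [h4]; rfl

end
end CP

namespace CP
section
variable {k L : Type*}
  [Field k] [LinearOrder k] [IsStrictOrderedRing k]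
  [Field L] [LinearOrder L] [IsStrictOrderedRing L]

lemma emono (e : k →+* L) (he : ∀ b, 0 < e b ↔ 0 < b) (x y : k) : e x < e y ↔ x < y := by
  rw [← sub_pos, ← map_sub, he, sub_pos]

lemma onevar (hk : IVP k) (hL : IVP L) (e : k →+* L) (he : ∀ b, 0 < e b ↔ 0 < b) (t : L)
    (s : Finset (Polynomial k)) : ∃ r : k, ∀ p ∈ s, 0 < p.eval r ↔ 0 < p.eval₂ e t := by
  classical
  by_cases ht : ∃ r, e r = t
  · obtain ⟨r, rfl⟩ := ht
    exact ⟨r, fun p _ => by rw [Polynomial.eval₂_at_apply, he]⟩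
  push Not at ht
  set Z : Finset k := s.biUnion (fun p => p.roots.toFinset) with hZ
  obtain ⟨r, hr1, hr2⟩ := Order.exists_between_finsets (Z.filter (fun z => e z < t)) (Z.filter (fun z => t < e z)) (by
    intro x hx y hy
    rw [Finset.mem_filter] at hx hy
    exact (emono e he x y).1 (hx.2.trans hy.2))
  refine ⟨r, fun p hp => ?_⟩
  rcases eq_or_ne p 0 with rfl | hp0
  · simp
  have key : 0 < (p.map e).eval (e r) * (p.map e).eval t := by
    by_contra hcon
    push Not at hcon
    have hroot : ∀ w, (p.map e).eval w = 0 → ∃ z ∈ Z, e z = w := by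
      intro w hw
      rw [Polynomial.eval_map] at hw
      obtain ⟨z, rfl⟩ := hL.rel_closed hk e he p hp0 w hw
      refine ⟨z, ?_, rfl⟩
      rw [Polynomial.eval₂_at_apply] at hw
      have := (map_eq_zero e).1 hw
      rw [hZ, Finset.mem_biUnion]
      exact ⟨p, hp, by simp [hp0, this]⟩
    rcases le_total (e r) t with h | h
    · obtain ⟨w, h1, h2, h3⟩ := hL.of_mul (p.map e) h hcon
      obtain ⟨z, hz, rfl⟩ := hroot w h3
      have := hr1 z (Finset.mem_filter.2 ⟨hz, lt_of_le_of_ne h2 (ht z)⟩)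
      exact absurd ((emono e he _ _).2 this) (not_lt.2 h1)
    · obtain ⟨w, h1, h2, h3⟩ := hL.of_mul (p.map e) h (by rw [mul_comm]; exact hcon)
      obtain ⟨z, hz, rfl⟩ := hroot w h3
      have := hr2 z (Finset.mem_filter.2 ⟨hz, lt_of_le_of_ne h1 (ht z).symm⟩)
      exact absurd ((emono e he _ _).2 this) (not_lt.2 h2)
  rw [← he, ← Polynomial.eval₂_at_apply, ← Polynomial.eval_map, ← Polynomial.eval_map]
  exact pos_iff_pos_of_mul_pos key
end

section
variable {k : Type} [Field k] [LinearOrder k] [IsStrictOrderedRing k]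

lemma ivp_germ {α : Type} (hk : IVP k) (U : Ultrafilter α) : IVP (Filter.Germ (U : Filter α) k) := by
  intro p a b hab h1 h2
  obtain ⟨P, rfl⟩ := Polynomial.map_surjective (Filter.Germ.coeRingHom (U : Filter α) : (α → k) →+* _)
    (fun g => by obtain ⟨f, rfl⟩ := g.exists_rep; exact ⟨f, rfl⟩) p
  obtain ⟨a, rfl⟩ := a.exists_rep
  obtain ⟨b, rfl⟩ := b.exists_rep
  have hev : ∀ c : α → k, (P.map (Filter.Germ.coeRingHom (U : Filter α) : (α → k) →+* _)).eval (c : Filter.Germ (U : Filter α) k) = ((fun x => (P.map (Pi.evalRingHom (fun _ => k) x)).eval (c x) : α → k) : Filter.Germ (U : Filter α) k) := by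
    intro c
    have h0 : (fun x => (P.map (Pi.evalRingHom (fun _ => k) x)).eval (c x)) = P.eval c := by
      funext x
      rw [Polynomial.eval_map]
      have := Polynomial.eval₂_at_apply (p := P) (Pi.evalRingHom (fun _ => k) x) c
      simpa using this
    rw [h0, Polynomial.eval_map]
    exact Polynomial.eval₂_at_apply (p := P) (Filter.Germ.coeRingHom (U : Filter α)) c
  have key : ∀ x, ∃ c, a x ≤ b x → (P.map (Pi.evalRingHom (fun _ => k) x)).eval (a x) ≤ 0 →
      0 ≤ (P.map (Pi.evalRingHom (fun _ => k) x)).eval (b x) → a x ≤ c ∧ c ≤ b x ∧ (P.map (Pi.evalRingHom (fun _ => k) x)).eval c = 0 := by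
    intro x
    by_cases h : a x ≤ b x ∧ (P.map (Pi.evalRingHom (fun _ => k) x)).eval (a x) ≤ 0 ∧
      0 ≤ (P.map (Pi.evalRingHom (fun _ => k) x)).eval (b x)
    · obtain ⟨c, hc⟩ := hk _ _ _ h.1 h.2.1 h.2.2
      exact ⟨c, fun _ _ _ => hc⟩
    · exact ⟨0, fun h1 h2 h3 => absurd ⟨h1, h2, h3⟩ h⟩
  choose c hc using key
  have e1 : ∀ᶠ x in (U : Filter α), a x ≤ b x := Filter.Germ.coe_le.1 hab
  have e2 : ∀ᶠ x in (U : Filter α), (P.map (Pi.evalRingHom (fun _ => k) x)).eval (a x) ≤ 0 := by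
    have := h1; erw [hev] at this; exact Filter.Germ.coe_le.1 this
  have e3 : ∀ᶠ x in (U : Filter α), 0 ≤ (P.map (Pi.evalRingHom (fun _ => k) x)).eval (b x) := by
    have := h2; erw [hev] at this; exact Filter.Germ.coe_le.1 this
  refine ⟨(c : Filter.Germ (U : Filter α) k), ?_, ?_, ?_⟩
  · apply Filter.Germ.coe_le.2
    filter_upwards [e1, e2, e3] with x h1 h2 h3 using (hc x h1 h2 h3).1
  · apply Filter.Germ.coe_le.2
    filter_upwards [e1, e2, e3] with x h1 h2 h3 using (hc x h1 h2 h3).2.1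
  · rw [hev]
    apply Filter.Germ.coe_eq.2
    filter_upwards [e1, e2, e3] with x h1 h2 h3 using (hc x h1 h2 h3).2.2
end
end CP

namespace CP
section
variable {k L : Type}
  [Field k] [LinearOrder k] [IsStrictOrderedRing k]
  [Field L] [LinearOrder L] [IsStrictOrderedRing L]

lemma exists_ultra (hk : IVP k) (hL : IVP L) (e : k →+* L) (he : ∀ b, 0 < e b ↔ 0 < b) (t : L) :
    ∃ U : Ultrafilter k, ∀ p : Polynomial k, ∀ᶠ r in (U : Filter k), (0 < p.eval r ↔ 0 < p.eval₂ e t) := by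
  classical
  set V : Polynomial k → Set k := fun p => {r | 0 < p.eval r ↔ 0 < p.eval₂ e t} with hV
  have : (Filter.generate (Set.range V)).NeBot := by
    rw [Filter.generate_neBot_iff]
    intro T hT hTf
    obtain ⟨s, hs⟩ := hTf.exists_finset_coe
    have : ∀ v ∈ s, ∃ p, V p = v := by
      intro v hv; apply hT; rw [← hs]; exact hv
    choose! q hq using this
    obtain ⟨r, hr⟩ := onevar hk hL e he t (s.image q)
    refine ⟨r, ?_⟩
    rw [Set.mem_sInter]
    intro v hv
    rw [← hs] at hv
    rw [← hq v hv]
    exact hr _ (Finset.mem_image_of_mem q hv)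
  refine ⟨Ultrafilter.of (Filter.generate (Set.range V)), fun p => ?_⟩
  exact Ultrafilter.of_le _ (Filter.mem_generate_of_mem ⟨p, rfl⟩)

/-- the hom to the product -/
noncomputable def phi (e : k →+* L) (t : L) (U : Ultrafilter k) : Polynomial k →+* L × Filter.Germ (U : Filter k) k :=
  RingHom.prod (Polynomial.eval₂RingHom e t)
   ((Filter.Germ.coeRingHom (U : Filter k)).comp (RingHom.pi (fun r : k => Polynomial.evalRingHom r)))

lemma phi_good (e : k →+* L) (t : L) (U : Ultrafilter k)
    (hU : ∀ p : Polynomial k, ∀ᶠ r in (U : Filter k), (0 < p.eval r ↔ 0 < p.eval₂ e t)) : Good (phi e t U).range := by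
  rintro s ⟨p, rfl⟩
  have h := hU p
  have e2 : 0 < (phi e t U p).2 ↔ ∀ᶠ r in (U : Filter k), 0 < p.eval r := Filter.Germ.coe_pos
  rw [e2]
  change 0 < p.eval₂ e t ↔ _
  constructor
  · intro h1
    filter_upwards [h] with r hr using hr.2 h1
  · intro h1
    obtain ⟨r, hr, hr2⟩ := (h.and h1).exists
    exact hr.1 hr2
end

section
variable {A B : Type}
  [Field A] [LinearOrder A] [IsStrictOrderedRing A]
  [Field B] [LinearOrder B] [IsStrictOrderedRing B]

/-- image subfield -/
def subE {S : Subring (A × B)} (hS : MaxGood S) : Subfield A :=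
  { (ii S).range with
    inv_mem' := by
      rintro x ⟨c, rfl⟩
      by_cases hc : c = 0
      · exact ⟨0, by simp [hc]⟩
      · obtain ⟨d, hd⟩ := hS.inv c hc
        refine ⟨d, ?_⟩
        have := congrArg (ii S) hd
        rw [map_mul, map_one] at this
        exact (inv_eq_of_mul_eq_one_right this).symm }

/-- corestriction -/
def rho {S : Subring (A × B)} (hS : MaxGood S) : S →+* subE hS :=
  (ii S).codRestrict (subE hS) (fun c => ⟨c, rfl⟩)

lemma rho_surj {S : Subring (A × B)} (hS : MaxGood S) : Function.Surjective (rho hS) := by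
  rintro ⟨x, c, rfl⟩
  exact ⟨c, rfl⟩

lemma subE_ivp {S : Subring (A × B)} (hS : MaxGood S) (hA : IVP A) (hB : IVP B) : IVP (subE hS) := by
  intro p a b hab h1 h2
  by_cases hp : p = 0
  · exact ⟨a, le_rfl, hab, by simp [hp]⟩
  have hev : ∀ x : subE hS, (p.map (subE hS).subtype).eval (x : A) = ((p.eval x : subE hS) : A) := by
    intro x
    rw [Polynomial.eval_map]
    exact Polynomial.eval₂_at_apply (subE hS).subtype x
  obtain ⟨c, h3, h4, h5⟩ := hA (p.map (subE hS).subtype) a b hab (by rw [hev]; exact h1) (by rw [hev]; exact h2)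
  obtain ⟨f, rfl⟩ := Polynomial.map_surjective _ (rho_surj hS) p
  have hf : f ≠ 0 := by rintro rfl; simp at hp
  obtain ⟨d, rfl⟩ := (hS.alg hA hB _ f hf (Nat.lt_succ_self _)).1 c (by
    rw [Polynomial.map_map, Polynomial.eval_map] at h5; exact h5)
  refine ⟨rho hS d, h3, h4, ?_⟩
  have := hev (rho hS d)
  apply Subtype.ext
  rw [← this]; exact h5
end

theorem art : ∀ (n : ℕ) (k L : Type)
  [Field k] [LinearOrder k] [IsStrictOrderedRing k]
  [Field L] [LinearOrder L] [IsStrictOrderedRing L]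
  (_ : IVP k) (_ : IVP L) (e : k →+* L) (_ : ∀ b, 0 < e b ↔ 0 < b) (a : Fin n → L)
  (P : Finset (MvPolynomial (Fin n) k)),
  ∃ b : Fin n → k, ∀ p ∈ P, 0 < eval₂ e a p ↔ 0 < eval b p := by
  intro n
  induction n with
  | zero =>
    intro k L _ _ _ _ _ _ hk hL e he a P
    refine ⟨Fin.elim0, fun p _ => ?_⟩
    rw [← he (eval _ p), ← eval₂_id, eval₂_comp_left]
    have : a = e ∘ Fin.elim0 := by funext i; exact i.elim0
    rw [this]; rfl
  | succ n ih =>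
    intro k L _ _ _ _ _ _ hk hL e he a P
    classical
    obtain ⟨U, hU⟩ := exists_ultra hk hL e he (a 0)
    obtain ⟨S, hS0, hS⟩ := exists_maxGood _ (phi_good e (a 0) U hU)
    have hB : IVP (Filter.Germ (U : Filter k) k) := ivp_germ hk U
    set φ : Polynomial k →+* S := (phi e (a 0) U).codRestrict S (fun p => hS0 ⟨p, rfl⟩) with hφ
    set eS : k →+* S := φ.comp Polynomial.C with heS
    set tS : S := φ Polynomial.X with htS
    set spec : MvPolynomial (Fin (n+1)) k → MvPolynomial (Fin n) (subE hS) :=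
      eval₂ (C.comp ((rho hS).comp eS)) (Fin.cons (C (rho hS tS)) X) with hspec
    obtain ⟨b', hb'⟩ := ih (subE hS) L (subE_ivp hS hL hB) hL (subE hS).subtype (fun b => Iff.rfl)
      (fun i => a i.succ) (P.image spec)
    choose s hs using fun i => rho_surj hS (b' i)
    choose g hg using fun i => (jj S (s i)).exists_rep
    have h1 : ∀ p, eval₂ (subE hS).subtype (fun i => a i.succ) (spec p) = eval₂ e a p := by
      intro p
      have := eval₂_comp_left (eval₂Hom (subE hS).subtype (fun i => a i.succ)) (C.comp ((rho hS).comp eS)) (Fin.cons (C (rho hS tS)) X) p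
      rw [coe_eval₂Hom] at this
      rw [hspec, this]
      congr 1
      · ext c
        simp [heS, hφ, rho, ii, phi]
      · funext i
        refine Fin.cases ?_ (fun i => ?_) i
        · simp [htS, hφ, rho, ii, phi]
        · simp
    have h2 : ∀ p, eval b' (spec p) = rho hS (eval₂ eS (Fin.cons tS s) p) := by
      intro p
      rw [hspec, eval₂_comp_left, eval₂_comp_left]
      congr 1
      · ext c
        simp
      · funext i
        refine Fin.cases ?_ (fun i => ?_) i
        · simp
        · simp [hs]
    have h3 : ∀ p, jj S (eval₂ eS (Fin.cons tS s) p) =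
        ((fun r => eval (Fin.cons r (fun i => g i r) : Fin (n+1) → k) p : k → k) : Filter.Germ (U : Filter k) k) := by
      intro p
      have e1 : (fun r => eval (Fin.cons r (fun i => g i r) : Fin (n+1) → k) p : k → k) =
         eval₂ (Pi.constRingHom k k) (Fin.cons id g : Fin (n+1) → (k → k)) p := by
        funext r
        have := eval₂_comp_left (Pi.evalRingHom (fun _ : k => k) r) (Pi.constRingHom k k) (Fin.cons id g : Fin (n+1) → (k → k)) p
        rw [Pi.evalRingHom_apply] at this
        rw [this, ← eval₂_id]
        congr 1
        funext i
        refine Fin.cases ?_ (fun i => ?_) i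
        · simp
        · simp
      rw [e1]
      have := eval₂_comp_left (Filter.Germ.coeRingHom (U : Filter k)) (Pi.constRingHom k k) (Fin.cons id g : Fin (n+1) → (k → k)) p
      rw [eval₂_comp_left]
      refine Eq.trans ?_ this.symm
      congr 1
      · ext c
        simp [heS, hφ, jj, phi]
        refine Filter.Eventually.of_forall (fun r => ?_)
        simp
      · funext i
        refine Fin.cases ?_ (fun i => ?_) i
        · simp [htS, hφ, jj, phi]
          refine Filter.Eventually.of_forall (fun r => ?_)
          simp
        · simp [← hg]
          rfl
    have h4 : ∀ p ∈ P, ∀ᶠ r in (U : Filter k), (0 < eval₂ e a p ↔ 0 < eval (Fin.cons r (fun i => g i r) : Fin (n+1) → k) p) := by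
      intro p hp
      have e1 := hb' _ (Finset.mem_image_of_mem spec hp)
      rw [h1, h2] at e1
      have e2 : 0 < rho hS (eval₂ eS (Fin.cons tS s) p) ↔ 0 < ii S (eval₂ eS (Fin.cons tS s) p) := Iff.rfl
      rw [e2, hS.1.sgn, h3, Filter.Germ.coe_pos] at e1
      by_cases h : 0 < eval₂ e a p
      · filter_upwards [e1.1 h] with r hr using ⟨fun _ => hr, fun _ => h⟩
      · have := (not_congr e1).1 h
        rw [← Ultrafilter.eventually_not] at this
        filter_upwards [this] with r hr using ⟨fun h' => absurd h' h, fun h' => absurd h' hr⟩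
    rw [← Filter.eventually_all_finset] at h4
    obtain ⟨r, hr⟩ := h4.exists
    exact ⟨_, hr⟩
end CP

namespace CP

/-- adjoin an element to a cone -/
def adj {A : Type*} [CommRing A] (T : Subsemiring A) (w : A) (hw : w * w ∈ T) : Subsemiring A where
  carrier := {x | ∃ s ∈ T, ∃ t ∈ T, x = s + t * w}
  zero_mem' := ⟨0, T.zero_mem, 0, T.zero_mem, by simp⟩
  one_mem' := ⟨1, T.one_mem, 0, T.zero_mem, by simp⟩
  add_mem' := by
    rintro _ _ ⟨s, hs, t, ht, rfl⟩ ⟨s', hs', t', ht', rfl⟩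
    exact ⟨s + s', T.add_mem hs hs', t + t', T.add_mem ht ht', by ring⟩
  mul_mem' := by
    rintro _ _ ⟨s, hs, t, ht, rfl⟩ ⟨s', hs', t', ht', rfl⟩
    exact ⟨s * s' + t * t' * (w * w), T.add_mem (T.mul_mem hs hs') (T.mul_mem (T.mul_mem ht ht') hw),
      s * t' + s' * t, T.add_mem (T.mul_mem hs ht') (T.mul_mem hs' ht), by ring⟩

lemma le_adj {A : Type*} [CommRing A] (T : Subsemiring A) (w : A) (hw : w * w ∈ T) : T ≤ adj T w hw :=
  fun x hx => ⟨x, hx, 0, T.zero_mem, by simp⟩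

lemma mem_adj {A : Type*} [CommRing A] (T : Subsemiring A) (w : A) (hw : w * w ∈ T) : w ∈ adj T w hw :=
  ⟨0, T.zero_mem, 1, T.one_mem, by simp⟩

lemma lemmaW {K : Type*} [Field K] [LinearOrder K] [IsStrictOrderedRing K] {ι : Type*} [Fintype ι] (a b : K)
    (c : ι → K) (hc : ∀ i, 0 ≤ c i) :
    ∀ (n : ℕ) (q : Polynomial K), q.natDegree < n → q.eval a * q.eval b < 0 → ∀ f : ι → Polynomial K,
      ¬ q ∣ 1 + ∑ i, Polynomial.C (c i) * f i ^ 2 := by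
  intro n
  induction n with
  | zero => intro q h; omega
  | succ n ih =>
    intro q hqn hq f hdvd
    have hq0 : q ≠ 0 := by rintro rfl; simp at hq
    have hqd : 0 < q.natDegree := by
      by_contra h
      have h' : q.natDegree = 0 := by omega
      obtain ⟨d, rfl⟩ := Polynomial.natDegree_eq_zero.1 h'
      simp at hq
      nlinarith [mul_self_nonneg d]
    set f' : ι → Polynomial K := fun i => f i % q with hf'
    set H : Polynomial K := 1 + ∑ i, Polynomial.C (c i) * f' i ^ 2 with hH
    have hdH : q ∣ H := by
      have : (1 + ∑ i, Polynomial.C (c i) * f i ^ 2) - H = ∑ i, Polynomial.C (c i) * (f i + f' i) * (f i - f' i) := by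
        rw [hH, add_sub_add_left_eq_sub, ← Finset.sum_sub_distrib]
        apply Finset.sum_congr rfl
        intro i _; ring
      have h2 : q ∣ (1 + ∑ i, Polynomial.C (c i) * f i ^ 2) - H := by
        rw [this]
        apply Finset.dvd_sum
        intro i _
        apply Dvd.dvd.mul_left
        refine ⟨f i / q, ?_⟩
        have := EuclideanDomain.div_add_mod (f i) q
        simp only [hf']
        linear_combination -this
      exact (dvd_sub_right hdvd).1 (by simpa using h2)
    have hpos : ∀ x, 0 < H.eval x := by
      intro x
      rw [hH]
      simp only [Polynomial.eval_add, Polynomial.eval_one, Polynomial.eval_finsetSum, Polynomial.eval_mul, Polynomial.eval_C, Polynomial.eval_pow]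
      have : 0 ≤ ∑ i, c i * (f' i).eval x ^ 2 := Finset.sum_nonneg (fun i _ => mul_nonneg (hc i) (sq_nonneg _))
      linarith
    obtain ⟨g, hg⟩ := hdH
    have hg0 : g ≠ 0 := by
      rintro rfl
      have := hpos 0
      rw [hg] at this; simp at this
    have hdegH : H.natDegree ≤ 2 * (q.natDegree - 1) := by
      rw [hH]
      apply Polynomial.natDegree_add_le_of_degree_le (by simp)
      apply Polynomial.natDegree_sum_le_of_forall_le
      intro i _
      refine (Polynomial.natDegree_C_mul_le _ _).trans ?_
      refine Polynomial.natDegree_pow_le.trans ?_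
      have : (f' i).natDegree < q.natDegree := Polynomial.natDegree_mod_lt _ hqd.ne'
      omega
    have hdeg : g.natDegree < n := by
      rw [hg, Polynomial.natDegree_mul hq0 hg0] at hdegH
      omega
    refine ih g hdeg ?_ f' ⟨q, by rw [← hH, hg, mul_comm]⟩
    have h1 := hpos a
    have h2 := hpos b
    rw [hg, Polynomial.eval_mul] at h1 h2
    by_contra h3
    push Not at h3
    nlinarith [mul_pos h1 h2]

lemma exists_irr {K : Type*} [Field K] [LinearOrder K] [IsStrictOrderedRing K] (a b : K) (p : Polynomial K) :
    p.eval a * p.eval b < 0 → ∃ q, Irreducible q ∧ q ∣ p ∧ q.eval a * q.eval b < 0 := by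
  refine WfDvdMonoid.induction_on_irreducible (motive := fun p => p.eval a * p.eval b < 0 → ∃ q, Irreducible q ∧ q ∣ p ∧ q.eval a * q.eval b < 0) p ?_ ?_ ?_
  · intro h; simp at h
  · intro u hu h
    obtain ⟨d, _, rfl⟩ := Polynomial.isUnit_iff.1 hu
    simp at h
    nlinarith [mul_self_nonneg d]
  · intro r q _ hq ih h
    by_cases h1 : q.eval a * q.eval b < 0
    · exact ⟨q, hq, dvd_mul_right _ _, h1⟩
    · obtain ⟨q', h2, h3, h4⟩ := ih (by
        simp only [Polynomial.eval_mul] at h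
        push Not at h1
        by_contra h5
        push Not at h5
        nlinarith [mul_nonneg h1 h5])
      exact ⟨q', h2, h3.mul_left _, h4⟩

lemma exists_order {F : Type*} [Field F] (T : Subsemiring F) (h1 : ∀ x, x ∈ T ∨ -x ∈ T)
    (h2 : ∀ x, x ∈ T → -x ∈ T → x = 0) :
    ∃ (_ : LinearOrder F) (_ : IsStrictOrderedRing F), ∀ x : F, 0 ≤ x ↔ x ∈ T := by
  classical
  let Cn : RingCone F := { T with eq_zero_of_mem_of_neg_mem' := fun {a} => h2 a }
  haveI : HasMemOrNegMem Cn := ⟨h1⟩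
  letI lo : LinearOrder F := LinearOrder.mkOfAddGroupCone Cn
  haveI : IsOrderedRing F := IsOrderedRing.mkOfCone Cn
  refine ⟨lo, IsOrderedRing.toIsStrictOrderedRing F, fun x => ?_⟩
  change x - 0 ∈ Cn ↔ _
  rw [sub_zero]; rfl
end CP

namespace CP

/-- preordered subfields -/
structure PF {Ω : Type*} [Field Ω] (x : Subfield Ω × Subsemiring Ω) : Prop where
  sub : ∀ t ∈ x.2, t ∈ x.1
  sq : ∀ t ∈ x.1, t * t ∈ x.2
  neg : (-1 : Ω) ∉ x.2

lemma exists_maxPF {Ω : Type*} [Field Ω] (x : Subfield Ω × Subsemiring Ω) (hx : PF x) :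
    ∃ m, x ≤ m ∧ PF m ∧ ∀ y, PF y → m ≤ y → y ≤ m := by
  obtain ⟨m, h1, h2⟩ := zorn_le_nonempty₀ {x : Subfield Ω × Subsemiring Ω | PF x} (by
    intro c hc hch y hy
    have d1 : DirectedOn (· ≤ ·) (Prod.fst '' c) := by
      rintro _ ⟨a, ha, rfl⟩ _ ⟨b, hb, rfl⟩
      obtain ⟨z, hz, h1, h2⟩ := hch.directedOn a ha b hb
      exact ⟨z.1, ⟨z, hz, rfl⟩, h1.1, h2.1⟩
    have d2 : DirectedOn (· ≤ ·) (Prod.snd '' c) := by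
      rintro _ ⟨a, ha, rfl⟩ _ ⟨b, hb, rfl⟩
      obtain ⟨z, hz, h1, h2⟩ := hch.directedOn a ha b hb
      exact ⟨z.2, ⟨z, hz, rfl⟩, h1.2, h2.2⟩
    have n1 : (Prod.fst '' c).Nonempty := ⟨_, y, hy, rfl⟩
    have n2 : (Prod.snd '' c).Nonempty := ⟨_, y, hy, rfl⟩
    refine ⟨(sSup (Prod.fst '' c), sSup (Prod.snd '' c)), ⟨?_, ?_, ?_⟩, ?_⟩
    · intro t ht
      rw [Subsemiring.mem_sSup_of_directedOn n2 d2] at ht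
      obtain ⟨_, ⟨z, hz, rfl⟩, ht⟩ := ht
      rw [Subfield.mem_sSup_of_directedOn n1 d1]
      exact ⟨_, ⟨z, hz, rfl⟩, (hc hz).sub t ht⟩
    · intro t ht
      rw [Subfield.mem_sSup_of_directedOn n1 d1] at ht
      obtain ⟨_, ⟨z, hz, rfl⟩, ht⟩ := ht
      rw [Subsemiring.mem_sSup_of_directedOn n2 d2]
      exact ⟨_, ⟨z, hz, rfl⟩, (hc hz).sq t ht⟩
    · intro ht
      rw [Subsemiring.mem_sSup_of_directedOn n2 d2] at ht
      obtain ⟨_, ⟨z, hz, rfl⟩, ht⟩ := ht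
      exact (hc hz).neg ht
    · intro z hz
      exact Prod.le_def.2 ⟨le_sSup ⟨z, hz, rfl⟩, le_sSup ⟨z, hz, rfl⟩⟩) x hx
  exact ⟨m, h1, h2.1, fun y h3 h4 => h2.2 h3 h4⟩

/-- weighted sums of squares -/
def wsos {Ω : Type} [Field Ω] (T : Subsemiring Ω) (E : Subfield Ω) : Subsemiring Ω where
  carrier := {x | ∃ (ι : Type) (_ : Fintype ι) (c y : ι → Ω), (∀ i, c i ∈ T) ∧ (∀ i, y i ∈ E) ∧ x = ∑ i, c i * y i ^ 2}
  zero_mem' := ⟨Empty, inferInstance, Empty.elim, Empty.elim, by simp, by simp, by simp⟩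
  one_mem' := ⟨Unit, inferInstance, fun _ => 1, fun _ => 1, fun _ => T.one_mem, fun _ => E.one_mem, by simp⟩
  add_mem' := by
    rintro _ _ ⟨ι, _, c, y, h1, h2, rfl⟩ ⟨ι', _, c', y', h1', h2', rfl⟩
    refine ⟨ι ⊕ ι', inferInstance, Sum.elim c c', Sum.elim y y', ?_, ?_, by simp⟩
    · rintro (i | i)
      exacts [h1 i, h1' i]
    · rintro (i | i)
      exacts [h2 i, h2' i]
  mul_mem' := by
    rintro _ _ ⟨ι, _, c, y, h1, h2, rfl⟩ ⟨ι', _, c', y', h1', h2', rfl⟩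
    refine ⟨ι × ι', inferInstance, fun i => c i.1 * c' i.2, fun i => y i.1 * y' i.2,
      fun i => T.mul_mem (h1 _) (h1' _), fun i => E.mul_mem (h2 _) (h2' _), ?_⟩
    rw [Finset.sum_mul_sum, Fintype.sum_prod_type]
    refine Finset.sum_congr rfl (fun i _ => Finset.sum_congr rfl (fun j _ => ?_))
    ring

section
variable {Ω : Type} [Field Ω] {E : Subfield Ω} {T : Subsemiring Ω}

lemma PF.total (h : PF (E, T)) (hm : ∀ y, PF y → (E, T) ≤ y → y ≤ (E, T)) (x : Ω) (hx : x ∈ E) :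
    x ∈ T ∨ -x ∈ T := by
  by_contra hcon
  push Not at hcon
  have hw : (-x) * (-x) ∈ T := h.sq (-x) (E.neg_mem hx)
  refine hcon.2 ((hm (E, adj T (-x) hw) ⟨?_, ?_, ?_⟩ (Prod.le_def.2 ⟨le_rfl, le_adj _ _ hw⟩)).2 (mem_adj T (-x) hw))
  · rintro _ ⟨s, hs, t, ht, rfl⟩
    exact E.add_mem (h.sub _ hs) (E.mul_mem (h.sub _ ht) (E.neg_mem hx))
  · intro t ht
    exact le_adj T (-x) hw (h.sq t ht)
  · rintro ⟨s, hs, t, ht, h1⟩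
    have ht0 : t ≠ 0 := by
      rintro rfl
      apply h.neg
      rw [h1]; simpa using hs
    apply hcon.1
    have h2 : x = (1 + s) * t * (t⁻¹ * t⁻¹) := by
      field_simp
      linear_combination h1
    rw [h2]
    exact T.mul_mem (T.mul_mem (T.add_mem T.one_mem hs) ht) (h.sq _ (E.inv_mem (h.sub _ ht)))

lemma PF.anti (h : PF (E, T)) (x : Ω) (hx : x ∈ T) (hx' : -x ∈ T) : x = 0 := by
  by_contra h0
  apply h.neg
  have : (-1 : Ω) = (-x) * x * (x⁻¹ * x⁻¹) := by field_simp
  rw [this]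
  exact T.mul_mem (T.mul_mem hx' hx) (h.sq _ (E.inv_mem (h.sub _ hx)))

/-- simple extension as subfield -/
noncomputable def simpleExt (E : Subfield Ω) (θ : Ω) (q : Polynomial E) (hq : Irreducible q)
    (h0 : q.eval₂ E.subtype θ = 0) : Subfield Ω :=
  { (Polynomial.eval₂RingHom E.subtype θ).range with
    inv_mem' := by
      rintro _ ⟨f, rfl⟩
      by_cases hd : q ∣ f
      · obtain ⟨g, rfl⟩ := hd
        refine ⟨0, ?_⟩
        simp [h0]
      · obtain ⟨u, v, huv⟩ := (hq.coprime_iff_not_dvd).2 hd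
        refine ⟨v, ?_⟩
        have := congrArg (Polynomial.eval₂RingHom E.subtype θ) huv
        rw [map_add, map_mul, map_mul, map_one, Polynomial.coe_eval₂RingHom, h0, mul_zero, zero_add] at this
        exact (inv_eq_of_mul_eq_one_left this).symm }

lemma PF.ivp [IsAlgClosed Ω] (h : PF (E, T)) (hm : ∀ y, PF y → (E, T) ≤ y → y ≤ (E, T))
    [LinearOrder E] [IsStrictOrderedRing E] (hT : ∀ x : E, 0 ≤ x ↔ (x : Ω) ∈ T) : IVP E := by
  intro p a b hab h1 h2
  rcases h1.eq_or_lt with h1 | h1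
  · exact ⟨a, le_rfl, hab, h1⟩
  rcases h2.eq_or_lt with h2 | h2
  · exact ⟨b, hab, le_rfl, h2.symm⟩
  obtain ⟨q, hq, hqp, hqab⟩ := exists_irr a b p (mul_neg_of_neg_of_pos h1 h2)
  obtain ⟨θ, hθ⟩ : ∃ θ : Ω, q.eval₂ E.subtype θ = 0 :=
    IsAlgClosed.exists_eval₂_eq_zero E.subtype q (Polynomial.degree_pos_of_irreducible hq).ne'
  have hdvd : ∀ f : Polynomial E, f.eval₂ E.subtype θ = 0 → q ∣ f := by
    intro f hf
    by_contra hd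
    obtain ⟨u, v, huv⟩ := (hq.coprime_iff_not_dvd).2 hd
    have := congrArg (Polynomial.eval₂RingHom E.subtype θ) huv
    rw [map_add, map_mul, map_mul, map_one, Polynomial.coe_eval₂RingHom, hθ, hf] at this
    simp at this
  set E' := simpleExt E θ q hq hθ with hE'
  have hEE' : ∀ x : E, (x : Ω) ∈ E' := fun x => ⟨Polynomial.C x, by simp⟩
  have hle := hm (E', wsos T E') ⟨by
      rintro _ ⟨ι, _, c, y, h1, h2, rfl⟩
      refine Subfield.sum_mem _ (fun i _ => E'.mul_mem (hEE' ⟨c i, h.sub _ (h1 i)⟩) (E'.pow_mem (h2 i) 2)), by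
      intro t ht
      exact ⟨Unit, inferInstance, fun _ => 1, fun _ => t, fun _ => T.one_mem, fun _ => ht, by simp; ring⟩, by
      rintro ⟨ι, _, c, y, h1, h2, h3⟩
      choose f hf using h2
      refine lemmaW a b (fun i => (⟨c i, h.sub _ (h1 i)⟩ : E)) (fun i => (hT _).2 (h1 i)) _ q (Nat.lt_succ_self _) hqab f (hdvd _ ?_)
      rw [Polynomial.eval₂_add, Polynomial.eval₂_one, Polynomial.eval₂_finsetSum]
      have : ∑ i, Polynomial.eval₂ E.subtype θ (Polynomial.C (⟨c i, h.sub _ (h1 i)⟩ : E) * f i ^ 2) = ∑ i, c i * y i ^ 2 := by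
        refine Finset.sum_congr rfl (fun i _ => ?_)
        rw [Polynomial.eval₂_mul, Polynomial.eval₂_C, Polynomial.eval₂_pow, ← hf i]; rfl
      rw [this, ← h3]; ring⟩ (Prod.le_def.2 ⟨fun x hx => hEE' ⟨x, hx⟩, fun t ht =>
        ⟨Unit, inferInstance, fun _ => t, fun _ => 1, fun _ => ht, fun _ => E'.one_mem, by simp⟩⟩)
  have hθE : θ ∈ E := hle.1 ⟨Polynomial.X, by simp⟩
  set c : E := ⟨θ, hθE⟩ with hc
  have hroot : q.eval c = 0 := by
    have : q.eval₂ E.subtype (E.subtype c) = 0 := hθ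
    rw [Polynomial.eval₂_at_apply] at this
    exact (map_eq_zero E.subtype).1 this
  obtain ⟨r, hr⟩ := Polynomial.dvd_iff_isRoot.2 hroot
  obtain ⟨u, _, rfl⟩ : ∃ u, IsUnit u ∧ Polynomial.C u = r := by
    rw [← Polynomial.isUnit_iff]
    rcases hq.isUnit_or_isUnit hr with h | h
    · exact absurd h (Polynomial.not_isUnit_X_sub_C c)
    · exact h
  rw [hr] at hqab
  simp at hqab
  have hpc : p.eval c = 0 := by
    obtain ⟨s, rfl⟩ := hqp
    rw [Polynomial.eval_mul, hroot, zero_mul]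
  have hkey : (a - c) * (b - c) < 0 := by
    by_contra hcon
    push Not at hcon
    nlinarith [mul_nonneg hcon (mul_self_nonneg u)]
  refine ⟨c, ?_, ?_, hpc⟩
  · by_contra hh; push Not at hh
    nlinarith [mul_nonneg (sub_nonneg.2 hh.le) (sub_nonneg.2 (hh.le.trans hab))]
  · by_contra hh; push Not at hh
    nlinarith [mul_nonneg (sub_nonneg.2 hh.le) (sub_nonneg.2 (hab.trans hh.le))]
end
end CP

namespace CP
section
variable {A : Type} [CommRing A]

lemma exists_maxcone (T : Subsemiring A) (h : (-1 : A) ∉ T) : ∃ M, T ≤ M ∧ (-1 : A) ∉ M ∧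
    ∀ S, M ≤ S → (-1 : A) ∉ S → S ≤ M := by
  obtain ⟨m, h1, h2⟩ := zorn_le_nonempty₀ {S : Subsemiring A | (-1 : A) ∉ S} (by
    intro c hc hchain y hy
    have hd : DirectedOn (· ≤ ·) c := hchain.directedOn
    refine ⟨sSup c, ?_, fun z hz => le_sSup hz⟩
    intro hs
    rw [Subsemiring.mem_sSup_of_directedOn ⟨y, hy⟩ hd] at hs
    obtain ⟨t, ht, hst⟩ := hs
    exact hc ht hst) T h
  exact ⟨m, h1, h2.1, fun S' h3 h4 => h2.2 h4 h3⟩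


lemma mc_wit {T : Subsemiring A} (hsq : ∀ x, x * x ∈ T) (_h1 : (-1 : A) ∉ T)
    (hm : ∀ S, T ≤ S → (-1 : A) ∉ S → S ≤ T) (x : A) (hx : x ∉ T) : ∃ s ∈ T, ∃ t ∈ T, -1 = s + t * x := by
  by_contra hcon
  exact hx (hm (adj T x (hsq x)) (le_adj _ _ _) hcon (mem_adj _ _ _))

lemma mc_total {T : Subsemiring A} (hsq : ∀ x, x * x ∈ T) (h1 : (-1 : A) ∉ T)
    (hm : ∀ S, T ≤ S → (-1 : A) ∉ S → S ≤ T) (x : A) : x ∈ T ∨ -x ∈ T := by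
  by_contra hcon
  push Not at hcon
  obtain ⟨s, hs, t, ht, e⟩ := mc_wit hsq h1 hm x hcon.1
  obtain ⟨s', hs', t', ht', e'⟩ := mc_wit hsq h1 hm (-x) hcon.2
  apply h1
  have : (-1 : A) = s + s' + s * s' + t * t' * (x * x) := by
    linear_combination (1 + s') * e + (- t * x) * e'
  rw [this]
  exact T.add_mem (T.add_mem (T.add_mem hs hs') (T.mul_mem hs hs')) (T.mul_mem (T.mul_mem ht ht') (hsq x))

lemma mc_prime {T : Subsemiring A} (hsq : ∀ x, x * x ∈ T) (h1 : (-1 : A) ∉ T)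
    (hm : ∀ S, T ≤ S → (-1 : A) ∉ S → S ≤ T) : ∃ p : Ideal A, p.IsPrime ∧ ∀ x, x ∈ p ↔ (x ∈ T ∧ -x ∈ T) := by
  let p : Ideal A :=
    { carrier := {x | x ∈ T ∧ -x ∈ T}
      zero_mem' := ⟨T.zero_mem, by simp [T.zero_mem]⟩
      add_mem' := by
        rintro a b ⟨h1, h2⟩ ⟨h3, h4⟩
        exact ⟨T.add_mem h1 h3, by rw [neg_add]; exact T.add_mem h2 h4⟩
      smul_mem' := by
        rintro c x ⟨h2, h3⟩
        rw [smul_eq_mul]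
        rcases mc_total hsq h1 hm c with h | h
        · exact ⟨T.mul_mem h h2, by rw [← mul_neg]; exact T.mul_mem h h3⟩
        · exact ⟨by rw [← neg_mul_neg]; exact T.mul_mem h h3, by rw [← neg_mul]; exact T.mul_mem h h2⟩ }
  have hp : ∀ x, x ∈ p ↔ (x ∈ T ∧ -x ∈ T) := fun x => Iff.rfl
  refine ⟨p, ⟨?_, ?_⟩, hp⟩
  · intro h
    have := (hp 1).1 (h ▸ Submodule.mem_top)
    exact h1 this.2
  · have key : ∀ a b, a * b ∈ p → a ∉ T → b ∉ T → False := by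
      intro a b hab ha hb
      obtain ⟨s, hs, t, ht, e⟩ := mc_wit hsq h1 hm a ha
      obtain ⟨s', hs', t', ht', e'⟩ := mc_wit hsq h1 hm b hb
      apply h1
      have h3 : (t * t') * (a * b) ∈ p := p.mul_mem_left _ hab
      have : (-1 : A) = s + s' + s * s' + -((t * t') * (a * b)) := by
        linear_combination (1 + s') * e + (- t * a) * e'
      rw [this]
      exact T.add_mem (T.add_mem (T.add_mem hs hs') (T.mul_mem hs hs')) h3.2
    intro a b hab
    by_contra hcon
    push Not at hcon
    rw [hp, hp, not_and_or, not_and_or] at hcon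
    rcases hcon with ⟨h2 | h2, h3 | h3⟩
    · exact key a b hab h2 h3
    · exact key a (-b) (by rw [mul_neg]; exact p.neg_mem hab) h2 h3
    · exact key (-a) b (by rw [neg_mul]; exact p.neg_mem hab) h2 h3
    · exact key (-a) (-b) (by rw [neg_mul_neg]; exact hab) h2 h3

theorem exists_ivp_ext (T : Subsemiring A) (hsq : ∀ x, x * x ∈ T) (h1 : (-1 : A) ∉ T) :
    ∃ (L : Type) (_ : Field L) (_ : LinearOrder L) (_ : IsStrictOrderedRing L) (φ : A →+* L),
      IVP L ∧ ∀ t ∈ T, 0 ≤ φ t := by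
  obtain ⟨M, hTM, hM1, hMm⟩ := exists_maxcone T h1
  have hMsq : ∀ x, x * x ∈ M := fun x => hTM (hsq x)
  obtain ⟨p, hp, hpm⟩ := mc_prime hMsq hM1 hMm
  let F := FractionRing (A ⧸ p)
  let Ω := AlgebraicClosure F
  let q : A →+* F := (algebraMap (A ⧸ p) F).comp (Ideal.Quotient.mk p)
  let φ : A →+* Ω := (algebraMap F Ω).comp q
  have hq0 : ∀ a, q a = 0 ↔ a ∈ p := by
    intro a
    rw [← Ideal.Quotient.eq_zero_iff_mem]
    exact (IsFractionRing.injective (A ⧸ p) F).eq_iff' (map_zero _)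
  have hφ0 : ∀ a, φ a = 0 ↔ a ∈ p := by
    intro a
    rw [← hq0]
    exact map_eq_zero (algebraMap F Ω)
  let E0 : Subfield Ω := (algebraMap F Ω).fieldRange
  have hφE : ∀ a, φ a ∈ E0 := fun a => ⟨q a, rfl⟩
  let T0 : Subsemiring Ω :=
    { carrier := {x | ∃ a t, t ∈ M ∧ φ a ≠ 0 ∧ x * (φ a * φ a) = φ t}
      zero_mem' := ⟨1, 0, M.zero_mem, by simp, by simp⟩
      one_mem' := ⟨1, 1, M.one_mem, by simp, by simp⟩
      add_mem' := by
        rintro x y ⟨a, t, ht, ha, e⟩ ⟨a', t', ht', ha', e'⟩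
        refine ⟨a * a', t * (a' * a') + t' * (a * a), M.add_mem (M.mul_mem ht (hMsq _)) (M.mul_mem ht' (hMsq _)), ?_, ?_⟩
        · rw [map_mul]; exact mul_ne_zero ha ha'
        · simp only [map_mul, map_add]
          linear_combination (φ a' * φ a') * e + (φ a * φ a) * e'
      mul_mem' := by
        rintro x y ⟨a, t, ht, ha, e⟩ ⟨a', t', ht', ha', e'⟩
        refine ⟨a * a', t * t', M.mul_mem ht ht', ?_, ?_⟩
        · rw [map_mul]; exact mul_ne_zero ha ha'
        · simp only [map_mul]
          linear_combination (y * (φ a' * φ a')) * e + φ t * e' }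
  have hPF : PF (E0, T0) := by
    refine ⟨?_, ?_, ?_⟩
    · rintro x ⟨a, t, ht, ha, e⟩
      have : x = φ t * (φ a * φ a)⁻¹ := by
        rw [eq_mul_inv_iff_mul_eq₀ (mul_ne_zero ha ha)]; exact e
      rw [this]
      exact E0.mul_mem (hφE _) (E0.inv_mem (E0.mul_mem (hφE _) (hφE _)))
    · rintro x ⟨z, rfl⟩
      obtain ⟨n, d, hd, hz⟩ := IsFractionRing.div_surjective (A := A ⧸ p) z
      obtain ⟨n, rfl⟩ := Ideal.Quotient.mk_surjective n
      obtain ⟨d, rfl⟩ := Ideal.Quotient.mk_surjective d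
      have hqd : q d ≠ 0 := by
        intro h
        have h2 : algebraMap (A ⧸ p) F (Ideal.Quotient.mk p d) = 0 := h
        rw [(IsFractionRing.injective (A ⧸ p) F).eq_iff' (map_zero _)] at h2
        exact nonZeroDivisors.ne_zero hd h2
      have hz' : z * q d = q n := by
        rw [← hz]; exact div_mul_cancel₀ _ hqd
      have hz2 : algebraMap F Ω z * φ d = φ n := by
        have := congrArg (algebraMap F Ω) hz'
        rwa [map_mul] at this
      refine ⟨d, n * n, hMsq n, fun h => hqd ((hq0 _).2 ((hφ0 _).1 h)), ?_⟩
      rw [map_mul]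
      linear_combination (algebraMap F Ω z * φ d + φ n) * hz2
    · rintro ⟨a, t, ht, ha, e⟩
      apply ha
      rw [hφ0]
      have h3 : a * a + t ∈ p := by
        rw [← hφ0, map_add, map_mul]; linear_combination -e
      have h4 : a * a ∈ p := by
        rw [hpm] at h3 ⊢
        refine ⟨hMsq a, ?_⟩
        have : -(a * a) = -(a * a + t) + t := by ring
        rw [this]; exact M.add_mem h3.2 ht
      rcases hp.mem_or_mem h4 with h | h <;> exact h
  obtain ⟨⟨E, T1⟩, hle, hPF1, hmax⟩ := exists_maxPF _ hPF
  let T2 : Subsemiring E := T1.comap E.subtype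
  obtain ⟨lo, so, hlo⟩ := exists_order T2 (fun x => hPF1.total hmax x x.2) (fun x hx hx' => by
    have := hPF1.anti (x : Ω) hx hx'
    exact Subtype.ext this)
  have hφ1 : ∀ a, φ a ∈ E := fun a => hle.1 (hφE a)
  refine ⟨E, inferInstance, lo, so, φ.codRestrict E hφ1, hPF1.ivp hmax hlo, ?_⟩
  intro t ht
  rw [hlo]
  exact hle.2 ⟨1, t, hTM ht, by simp, by simp⟩
end

lemma real_ivp : IVP ℝ := by
  intro p a b hab h1 h2
  obtain ⟨c, hc, hc2⟩ := intermediate_value_Icc hab (p.continuous.continuousOn) ⟨h1, h2⟩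
  exact ⟨c, hc.1, hc.2, hc2⟩

theorem stengle_fin {n : ℕ} {κ : Type} [Finite κ] (h : κ → MvPolynomial (Fin n) ℝ) (T : Subsemiring (MvPolynomial (Fin n) ℝ))
    (hsq : ∀ x, x * x ∈ T) (hT : ∀ j, h j ∈ T) (hempty : ∀ x, ∃ j, eval x (h j) < 0) :
    -1 ∈ T := by
  classical
  have := Fintype.ofFinite κ
  by_contra h1
  obtain ⟨L, _, _, _, φ, hL, hφ⟩ := exists_ivp_ext T hsq h1
  have he : ∀ b : ℝ, 0 < (φ.comp C) b ↔ 0 < b := by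
    have hn : ∀ b : ℝ, 0 ≤ b → 0 ≤ (φ.comp C) b := by
      intro b hb
      have : b = √b * √b := (Real.mul_self_sqrt hb).symm
      rw [this, map_mul]; exact mul_self_nonneg _
    intro b
    constructor
    · intro hb
      by_contra hcon
      push Not at hcon
      have := hn (-b) (by linarith)
      rw [map_neg] at this
      linarith
    · intro hb
      refine lt_of_le_of_ne (hn b hb.le) ?_
      intro h0
      exact hb.ne' ((map_eq_zero (φ.comp C)).1 h0.symm)
  obtain ⟨b, hb⟩ := art n ℝ L real_ivp hL (φ.comp C) he (fun i => φ (X i)) (Finset.univ.image (fun j => - h j))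
  obtain ⟨j, hj⟩ := hempty b
  have h2 := (hb _ (Finset.mem_image_of_mem (fun j => - h j) (Finset.mem_univ j))).2 (by simpa using hj)
  have h3 : ∀ p : MvPolynomial (Fin n) ℝ, eval₂ (φ.comp C) (fun i => φ (X i)) p = φ p := by
    intro p
    have : eval₂Hom (φ.comp C) (fun i => φ (X i)) = φ := by
      apply MvPolynomial.ringHom_ext <;> simp
    exact congrArg (fun f => f p) this
  rw [h3, map_neg] at h2
  have := hφ _ (hT j)
  linarith

theorem stengle {σ : Type} [Finite σ] {κ : Type} [Finite κ] (h : κ → MvPolynomial σ ℝ) (T : Subsemiring (MvPolynomial σ ℝ))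
    (hsq : ∀ x, x * x ∈ T) (hT : ∀ j, h j ∈ T) (hempty : ∀ x, ∃ j, eval x (h j) < 0) :
    -1 ∈ T := by
  obtain ⟨n, ⟨e⟩⟩ := Finite.exists_equiv_fin σ
  have h1 := stengle_fin (fun j => rename e (h j)) (T.comap (rename e.symm : MvPolynomial (Fin n) ℝ →ₐ[ℝ] MvPolynomial σ ℝ))
    (fun x => by rw [Subsemiring.mem_comap, map_mul]; exact hsq _)
    (fun j => by rw [Subsemiring.mem_comap]; simpa [rename_rename] using hT j)
    (fun x => by
      obtain ⟨j, hj⟩ := hempty (x ∘ e)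
      exact ⟨j, by rwa [eval_rename]⟩)
  rw [Subsemiring.mem_comap] at h1
  simpa using h1
end CP

namespace CP

lemma isSOS_iff {ι : Type*} (q : MvPolynomial ι ℝ) : IsSOS q ↔ IsSumSq q := by
  constructor
  · rintro ⟨k, s, rfl⟩
    refine IsSumSq.sum (fun i _ => ?_)
    rw [sq]; exact IsSumSq.mul_self _
  · intro h
    induction h with
    | zero => exact ⟨0, Fin.elim0, by simp⟩
    | sq_add a hs ih =>
      obtain ⟨k, s, rfl⟩ := ih
      exact ⟨k + 1, Fin.cons a s, by rw [Fin.sum_univ_succ]; simp [sq]⟩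

lemma IsSOS.zero {ι : Type*} : IsSOS (0 : MvPolynomial ι ℝ) := (isSOS_iff _).2 IsSumSq.zero
lemma IsSOS.add {ι : Type*} {p q : MvPolynomial ι ℝ} (hp : IsSOS p) (hq : IsSOS q) : IsSOS (p + q) :=
  (isSOS_iff _).2 (((isSOS_iff _).1 hp).add ((isSOS_iff _).1 hq))
lemma IsSOS.mul {ι : Type*} {p q : MvPolynomial ι ℝ} (hp : IsSOS p) (hq : IsSOS q) : IsSOS (p * q) :=
  (isSOS_iff _).2 (((isSOS_iff _).1 hp).mul ((isSOS_iff _).1 hq))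
lemma IsSOS.mul_self {ι : Type*} (p : MvPolynomial ι ℝ) : IsSOS (p * p) := (isSOS_iff _).2 (IsSumSq.mul_self _)
lemma IsSOS.sq {ι : Type*} (p : MvPolynomial ι ℝ) : IsSOS (p ^ 2) := by rw [_root_.sq]; exact IsSOS.mul_self p
lemma IsSOS.const {ι : Type*} {c : ℝ} (hc : 0 ≤ c) : IsSOS (C c : MvPolynomial ι ℝ) := by
  rw [← Real.mul_self_sqrt hc, C_mul]; exact IsSOS.mul_self _
lemma IsSOS.one {ι : Type*} : IsSOS (1 : MvPolynomial ι ℝ) := by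
  have := IsSOS.const (ι := ι) zero_le_one; rwa [C_1] at this
lemma IsSOS.sum {ι κ : Type*} {s : Finset κ} {f : κ → MvPolynomial ι ℝ} (h : ∀ i ∈ s, IsSOS (f i)) : IsSOS (∑ i ∈ s, f i) :=
  (isSOS_iff _).2 (IsSumSq.sum (fun i hi => (isSOS_iff _).1 (h i hi)))

section
variable {σ : Type} {T : Subsemiring (MvPolynomial σ ℝ)}

lemma const_mem (hsq : ∀ x, x * x ∈ T) {c : ℝ} (hc : 0 ≤ c) : C c ∈ T := by
  rw [← Real.mul_self_sqrt hc, C_mul]; exact hsq _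

lemma half_mem (hsq : ∀ x, x * x ∈ T) {p : MvPolynomial σ ℝ} (h : C 2 * p ∈ T) : p ∈ T := by
  have := T.mul_mem (const_mem hsq (c := 1/2) (by norm_num)) h
  rw [← mul_assoc, ← C_mul] at this
  norm_num at this
  exact this

lemma arch [Fintype σ] (hsq : ∀ x, x * x ∈ T) (R : ℝ) (hR : C R - ∑ i, X i ^ 2 ∈ T) (p : MvPolynomial σ ℝ) :
    ∃ N : ℝ, C N - p ∈ T ∧ C N + p ∈ T := by
  classical
  have hmul : ∀ p q : MvPolynomial σ ℝ, (∃ N : ℝ, C N - p ∈ T ∧ C N + p ∈ T) → (∃ N : ℝ, C N - q ∈ T ∧ C N + q ∈ T) →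
      (∃ N : ℝ, C N - p * q ∈ T ∧ C N + p * q ∈ T) := by
    rintro p q ⟨N, h1, h2⟩ ⟨M, h3, h4⟩
    refine ⟨N * M, half_mem hsq ?_, half_mem hsq ?_⟩
    · have := T.add_mem (T.mul_mem h1 h4) (T.mul_mem h2 h3)
      convert this using 1
      rw [C_mul, map_ofNat]; ring
    · have := T.add_mem (T.mul_mem h1 h3) (T.mul_mem h2 h4)
      convert this using 1
      rw [C_mul, map_ofNat]; ring
  induction p using MvPolynomial.induction_on with
  | C a =>
    refine ⟨|a|, ?_, ?_⟩
    · rw [← C_sub]; exact const_mem hsq (sub_nonneg.2 (le_abs_self a))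
    · rw [← C_add]; exact const_mem hsq (by linarith [neg_abs_le a])
  | add p q hp hq =>
    obtain ⟨N, h1, h2⟩ := hp
    obtain ⟨M, h3, h4⟩ := hq
    refine ⟨N + M, ?_, ?_⟩
    · convert T.add_mem h1 h3 using 1
      rw [C_add]; ring
    · convert T.add_mem h2 h4 using 1
      rw [C_add]; ring
  | mul_X p i hp =>
    refine hmul _ _ hp ?_
    have h1 : C R - X i ^ 2 ∈ T := by
      have h2 : ∑ j ∈ Finset.univ.erase i, (X j : MvPolynomial σ ℝ) ^ 2 ∈ T := by
        refine T.sum_mem (fun j _ => ?_)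
        rw [sq]; exact hsq _
      convert T.add_mem hR h2 using 1
      rw [← Finset.add_sum_erase _ _ (Finset.mem_univ i)]; ring
    have e : (C 2 * C ((R + 1) / 2) : MvPolynomial σ ℝ) = C R + 1 := by
      rw [← C_mul, ← C_1, ← C_add]; congr 1; ring
    refine ⟨(R + 1) / 2, half_mem hsq ?_, half_mem hsq ?_⟩
    · convert T.add_mem h1 (hsq (X i - 1)) using 1
      rw [mul_sub, e, map_ofNat]; ring
    · convert T.add_mem h1 (hsq (X i + 1)) using 1
      rw [mul_add, e, map_ofNat]; ring

lemma stengle_pos [Finite σ] {κ : Type} [Finite κ] (h : κ → MvPolynomial σ ℝ) (hsq : ∀ x, x * x ∈ T)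
    (hT : ∀ j, h j ∈ T) (f : MvPolynomial σ ℝ) (hf : ∀ x, (∀ j, 0 ≤ eval x (h j)) → 0 < eval x f) :
    ∃ t ∈ T, ∃ q ∈ T, t * f = 1 + q := by
  have := stengle (fun j : Option κ => j.elim (-f) h) (adj T (-f) (hsq _)) (fun x => le_adj _ _ _ (hsq x))
    (fun j => by
      cases j with
      | none => exact mem_adj _ _ _
      | some j => exact le_adj _ _ _ (hT j))
    (fun x => by
      by_contra hcon
      push Not at hcon
      have h1 := hf x (fun j => hcon (some j))
      have h2 := hcon none
      simp at h2
      linarith)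
  obtain ⟨s, hs, t, ht, e⟩ := this
  exact ⟨t, ht, s, hs, by linear_combination e⟩

theorem schmuedgen_aux [Fintype σ] {κ : Type} [Finite κ] (h : κ → MvPolynomial σ ℝ) (hsq : ∀ x, x * x ∈ T)
    (hT : ∀ j, h j ∈ T) (R : ℝ) (hR0 : 0 ≤ R) (hR : ∀ x, (∀ j, 0 ≤ eval x (h j)) → ∑ i, x i ^ 2 < R)
    (f : MvPolynomial σ ℝ) (hf : ∀ x, (∀ j, 0 ≤ eval x (h j)) → 0 < eval x f) : f ∈ T := by
  have hC : ∀ c : ℝ, 0 ≤ c → (C c : MvPolynomial σ ℝ) ∈ T := fun c hc => const_mem hsq hc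
  obtain ⟨R', hR'⟩ : ∃ R', C R' - ∑ i, X i ^ 2 ∈ T := by
    set p : MvPolynomial σ ℝ := C R - ∑ i, X i ^ 2 with hp
    obtain ⟨t, ht, q, hq, e⟩ := stengle_pos h hsq hT p (fun x hx => by
      have := hR x hx
      simp [hp]; linarith)
    have h1 : (1 + q) * p ∈ T := by
      rw [← e, mul_assoc]; exact T.mul_mem ht (hsq p)
    let S0 : Subsemiring (MvPolynomial σ ℝ) := Subsemiring.sumSq _
    have hS0 : ∀ x ∈ S0, x ∈ T := by
      intro x hx
      rw [Subsemiring.mem_sumSq] at hx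
      induction hx with
      | zero => exact T.zero_mem
      | sq_add a hs ih => exact T.add_mem (hsq a) ih
    have hS0sq : ∀ x, x * x ∈ S0 := fun x => by
      rw [Subsemiring.mem_sumSq]; exact IsSumSq.mul_self x
    obtain ⟨N, ⟨s0, hs0, s1, hs1, hN⟩, -⟩ := arch (T := adj S0 p (hS0sq p)) (fun x => le_adj _ _ _ (hS0sq x)) R
      (mem_adj _ _ _) q
    have h2 : (1 + q) * (C N - q) ∈ T := by
      rw [hN]
      have : (1 + q) * (s0 + s1 * p) = (1 + q) * s0 + s1 * ((1 + q) * p) := by ring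
      rw [this]
      exact T.add_mem (T.mul_mem (T.add_mem T.one_mem hq) (hS0 _ hs0)) (T.mul_mem (hS0 _ hs1) h1)
    have h3 : C (N + N ^ 2 / 4) - q ∈ T := by
      convert T.add_mem h2 (hsq (q - C (N / 2))) using 1
      have e1 : (C N : MvPolynomial σ ℝ) = 2 * C (N / 2) := by
        rw [← map_ofNat (C : ℝ →+* MvPolynomial σ ℝ) 2, ← C_mul]; congr 1; ring
      have e2 : (C (N + N ^ 2 / 4) : MvPolynomial σ ℝ) = 2 * C (N / 2) + C (N / 2) ^ 2 := by
        rw [← map_ofNat (C : ℝ →+* MvPolynomial σ ℝ) 2, ← C_mul, ← C_pow, ← C_add]; congr 1; ring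
      rw [e1, e2]; ring
    refine ⟨R + R * (N + N ^ 2 / 4), ?_⟩
    have h4 : q * ∑ i, X i ^ 2 ∈ T := by
      refine T.mul_mem hq (T.sum_mem (fun j _ => ?_))
      rw [sq]; exact hsq _
    convert T.add_mem (T.add_mem h1 h4) (T.mul_mem (hC R hR0) h3) using 1
    rw [hp, C_add, C_mul]; ring
  obtain ⟨t, ht, q, hq, e⟩ := stengle_pos h hsq hT f hf
  obtain ⟨N₀, hN₀, -⟩ := arch hsq R' hR' t
  obtain ⟨N, hN0, hN⟩ : ∃ N : ℝ, 0 < N ∧ C N - t ∈ T := by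
    refine ⟨|N₀| + 1, by positivity, ?_⟩
    convert T.add_mem hN₀ (hC (|N₀| + 1 - N₀) (by linarith [le_abs_self N₀])) using 1
    rw [C_sub]; ring
  obtain ⟨r, -, hr⟩ := arch hsq R' hR' f
  have step : ∀ k : ℕ, C ((k + 1 : ℕ) / N) + f ∈ T → C ((k : ℕ) / N) + f ∈ T := by
    intro k hk
    have h1 := T.add_mem (T.add_mem (T.mul_mem hN hk) (T.mul_mem (hC ((k + 1 : ℕ) / N) (by positivity)) ht)) hq
    have h2 := T.mul_mem (hC (1 / N) (by positivity)) h1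
    convert h2 using 1
    have e1 : (C N - t) * (C (((k + 1 : ℕ) : ℝ) / N) + f) + C (((k + 1 : ℕ) : ℝ) / N) * t + q
       = C N * (f + C ((k : ℝ) / N)) := by
      have : C N * C (((k + 1 : ℕ) : ℝ) / N) = (C N * C ((k : ℝ) / N) + 1 : MvPolynomial σ ℝ) := by
        rw [← C_mul, ← C_mul, ← C_1, ← C_add]; congr 1; push_cast; field_simp
      linear_combination -e + this
    rw [e1, ← mul_assoc, ← C_mul]
    have : 1 / N * N = 1 := by field_simp
    rw [this, C_1]; ring
  have all : ∀ k : ℕ, C ((k : ℕ) / N) + f ∈ T → f ∈ T := by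
    intro k
    induction k with
    | zero => intro h; simpa using h
    | succ k ih => intro h; exact ih (step k h)
  obtain ⟨k, hk⟩ := exists_nat_ge (r * N)
  refine all k ?_
  convert T.add_mem hr (hC (k / N - r) (by rw [sub_nonneg, le_div_iff₀ hN0]; exact hk)) using 1
  rw [C_sub]; ring
end
end CP

namespace CP

section
variable {σ κ : Type*} [Fintype κ] [DecidableEq κ] {h : κ → MvPolynomial σ ℝ}

lemma pre_add {p q : MvPolynomial σ ℝ} (hp : InPreordering h p) (hq : InPreordering h q) : InPreordering h (p + q) := by
  obtain ⟨c, h1, rfl⟩ := hp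
  obtain ⟨d, h2, rfl⟩ := hq
  refine ⟨fun J => c J + d J, fun J => IsSOS.add (h1 J) (h2 J), ?_⟩
  rw [← Finset.sum_add_distrib]
  exact Finset.sum_congr rfl (fun J _ => by ring)

lemma pre_zero : InPreordering h 0 := ⟨fun _ => 0, fun _ => IsSOS.zero, by simp⟩

lemma pre_single {s : MvPolynomial σ ℝ} (hs : IsSOS s) (J : Finset κ) : InPreordering h (s * ∏ j ∈ J, h j) := by
  refine ⟨fun I => if I = J then s else 0, fun I => ?_, ?_⟩
  · dsimp only
    split_ifs
    exacts [hs, IsSOS.zero]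
  · simp

lemma pre_sum {ι : Type*} (s : Finset ι) (f : ι → MvPolynomial σ ℝ) (hf : ∀ i ∈ s, InPreordering h (f i)) :
    InPreordering h (∑ i ∈ s, f i) := by
  classical
  induction s using Finset.induction_on with
  | empty => simpa using pre_zero
  | insert i s hi ih =>
    rw [Finset.sum_insert hi]
    exact pre_add (hf i (Finset.mem_insert_self _ _)) (ih (fun j hj => hf j (Finset.mem_insert_of_mem hj)))

lemma prod_symm (I J : Finset κ) : (∏ j ∈ I, h j) * ∏ j ∈ J, h j = (∏ j ∈ I ∩ J, h j) ^ 2 * ∏ j ∈ (I \ J) ∪ (J \ I), h j := by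
  have hd : Disjoint (I \ J) (J \ I) := by
    rw [Finset.disjoint_left]; intro a; simp; tauto
  rw [Finset.prod_union hd]
  have e1 := Finset.prod_inter_mul_prod_diff I J h
  have e2 := Finset.prod_inter_mul_prod_diff J I h
  rw [Finset.inter_comm J I] at e2
  rw [← e1, ← e2]; ring

lemma pre_mul {p q : MvPolynomial σ ℝ} (hp : InPreordering h p) (hq : InPreordering h q) : InPreordering h (p * q) := by
  obtain ⟨c, h1, rfl⟩ := hp
  obtain ⟨d, h2, rfl⟩ := hq
  rw [Finset.sum_mul_sum]
  refine pre_sum _ _ (fun I _ => pre_sum _ _ (fun J _ => ?_))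
  have : c I * (∏ j ∈ I, h j) * (d J * ∏ j ∈ J, h j) =
     (c I * d J * (∏ j ∈ I ∩ J, h j) ^ 2) * ∏ j ∈ (I \ J) ∪ (J \ I), h j := by
    rw [mul_assoc _ _ (∏ j ∈ (I \ J) ∪ (J \ I), h j), ← prod_symm]; ring
  rw [this]
  exact pre_single (IsSOS.mul (IsSOS.mul (h1 I) (h2 J)) (IsSOS.sq _)) _

lemma pre_sos {s : MvPolynomial σ ℝ} (hs : IsSOS s) : InPreordering h s := by
  simpa using pre_single (h := h) hs ∅

lemma pre_gen (j : κ) : InPreordering h (h j) := by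
  simpa using pre_single (h := h) IsSOS.one {j}

variable (h) in
/-- the preordering as a subsemiring -/
def preS : Subsemiring (MvPolynomial σ ℝ) where
  carrier := {p | InPreordering h p}
  zero_mem' := pre_zero
  one_mem' := pre_sos IsSOS.one
  add_mem' := pre_add
  mul_mem' := pre_mul
end

theorem schmuedgen {σ κ : Type} [Fintype σ] [Fintype κ] [DecidableEq κ] (h : κ → MvPolynomial σ ℝ)
    (R : ℝ) (hR : ∀ x, (∀ j, 0 ≤ eval x (h j)) → ∑ i, x i ^ 2 < R)
    (f : MvPolynomial σ ℝ) (hf : ∀ x, (∀ j, 0 ≤ eval x (h j)) → 0 < eval x f) : InPreordering h f :=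
  schmuedgen_aux (T := preS h) h (fun x => pre_sos (IsSOS.mul_self x)) (fun j => pre_gen j) |R| (abs_nonneg R)
    (fun x hx => (hR x hx).trans_le (le_abs_self R)) f hf

section
variable {σ : Type}

lemma box_half {Cn : AddSubmonoid (MvPolynomial σ ℝ)}
    (hsm : ∀ (c : ℝ) p, 0 ≤ c → p ∈ Cn → C c * p ∈ Cn) {p : MvPolynomial σ ℝ} (h : 2 * p ∈ Cn) : p ∈ Cn := by
  have := hsm (1/2) _ (by norm_num) h
  rw [← map_ofNat (C : ℝ →+* MvPolynomial σ ℝ) 2, ← mul_assoc, ← C_mul] at this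
  norm_num at this
  exact this

lemma box_prod {Cn : AddSubmonoid (MvPolynomial σ ℝ)} (hsos : ∀ p, IsSOS p → p ∈ Cn)
    (hsm : ∀ (c : ℝ) p, 0 ≤ c → p ∈ Cn → C c * p ∈ Cn) (hpow : ∀ i (r : ℕ), 1 - X i ^ (2 * r) ∈ Cn)
    (S : Finset σ) : ∀ e : σ → ℕ, 1 - (∏ i ∈ S, X i ^ e i) ^ 2 ∈ Cn := by
  classical
  induction S using Finset.induction_on with
  | empty => intro e; simp
  | insert i S hi ih =>
    intro e
    rw [Finset.prod_insert hi]
    apply box_half hsm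
    have h1 := ih (fun i => 2 * e i)
    have h2 := hpow i (2 * e i)
    have e1 : (∏ j ∈ S, (X j : MvPolynomial σ ℝ) ^ (2 * e j)) = (∏ j ∈ S, X j ^ e j) ^ 2 := by
      rw [← Finset.prod_pow]; exact Finset.prod_congr rfl (fun j _ => by rw [mul_comm, pow_mul])
    rw [e1] at h1
    have h3 := hsos _ (IsSOS.sq ((∏ j ∈ S, (X j : MvPolynomial σ ℝ) ^ e j) ^ 2 - (X i ^ e i) ^ 2))
    convert Cn.add_mem (Cn.add_mem h1 h2) h3 using 1
    have e2 : (X i : MvPolynomial σ ℝ) ^ (2 * (2 * e i)) = (X i ^ e i) ^ 4 := by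
      rw [← pow_mul]; congr 1; ring
    rw [e2]; ring

lemma box_mon [Fintype σ] {Cn : AddSubmonoid (MvPolynomial σ ℝ)} (hsos : ∀ p, IsSOS p → p ∈ Cn)
    (hsm : ∀ (c : ℝ) p, 0 ≤ c → p ∈ Cn → C c * p ∈ Cn) (hpow : ∀ i (r : ℕ), 1 - X i ^ (2 * r) ∈ Cn)
    (d : σ →₀ ℕ) (c : ℝ) : C |c| - monomial d c ∈ Cn := by
  have h0 : monomial d c = C c * ∏ i, X i ^ d i := by
    rw [monomial_eq, Finsupp.prod_fintype _ _ (by simp)]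
  have h1 := box_prod hsos hsm hpow Finset.univ d
  rw [h0]
  set m : MvPolynomial σ ℝ := ∏ i, X i ^ d i with hm
  have h2 : 1 - m ∈ Cn := by
    apply box_half hsm
    convert Cn.add_mem h1 (hsos _ (IsSOS.sq (1 - m))) using 1
    ring
  have h3 : 1 + m ∈ Cn := by
    apply box_half hsm
    convert Cn.add_mem h1 (hsos _ (IsSOS.sq (1 + m))) using 1
    ring
  rcases le_total 0 c with hc | hc
  · rw [abs_of_nonneg hc]
    convert hsm c _ hc h2 using 1; ring
  · rw [abs_of_nonpos hc]
    convert hsm (-c) _ (by linarith) h3 using 1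
    rw [C_neg]; ring

lemma box_bound [Fintype σ] {Cn : AddSubmonoid (MvPolynomial σ ℝ)} (hsos : ∀ p, IsSOS p → p ∈ Cn)
    (hsm : ∀ (c : ℝ) p, 0 ≤ c → p ∈ Cn → C c * p ∈ Cn) (hpow : ∀ i (r : ℕ), 1 - X i ^ (2 * r) ∈ Cn)
    (p : MvPolynomial σ ℝ) : ∃ B : ℝ, ∀ i (K : ℕ), C B - p * X i ^ K ∈ Cn := by
  induction p using MvPolynomial.induction_on' with
  | monomial d c =>
    refine ⟨|c|, fun i K => ?_⟩
    have := box_mon hsos hsm hpow (d + Finsupp.single i K) c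
    rwa [monomial_add_single] at this
  | add p q hp hq =>
    obtain ⟨B, hB⟩ := hp
    obtain ⟨B', hB'⟩ := hq
    refine ⟨B + B', fun i K => ?_⟩
    convert Cn.add_mem (hB i K) (hB' i K) using 1
    rw [C_add]; ring

lemma bern_sos (i : σ) (K : ℕ) : IsSOS ((X i ^ 2) ^ K - 1 - C (K : ℝ) * (X i ^ 2 - 1) : MvPolynomial σ ℝ) := by
  induction K with
  | zero => simpa using IsSOS.zero
  | succ K ih =>
    have h1 := IsSOS.add (IsSOS.mul (IsSOS.sq (X i)) ih) (IsSOS.mul (IsSOS.const (ι := σ) (c := (K : ℝ)) (by positivity)) (IsSOS.sq (X i ^ 2 - 1)))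
    convert h1 using 1
    push_cast
    rw [C_add, C_1]; ring

lemma box_bar [Fintype σ] {Cn : AddSubmonoid (MvPolynomial σ ℝ)} (hsos : ∀ p, IsSOS p → p ∈ Cn)
    (hsm : ∀ (c : ℝ) p, 0 ≤ c → p ∈ Cn → C c * p ∈ Cn) (hpow : ∀ i (r : ℕ), 1 - X i ^ (2 * r) ∈ Cn)
    (J : Finset σ) : ∀ s : MvPolynomial σ ℝ, IsSOS s → ∀ δ : ℝ, 0 < δ → s * ∏ j ∈ J, (1 - X j ^ 2) + C δ ∈ Cn := by
  classical
  induction J using Finset.induction_on with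
  | empty =>
    intro s hs δ hδ
    simpa using Cn.add_mem (hsos _ hs) (hsos _ (IsSOS.const hδ.le))
  | insert i J hi ih =>
    intro s hs δ hδ
    rw [Finset.prod_insert hi]
    set w : MvPolynomial σ ℝ := ∏ j ∈ J, (1 - X j ^ 2) with hw
    obtain ⟨B, hB⟩ := box_bound hsos hsm hpow (s * w)
    obtain ⟨K, hK⟩ := exists_nat_gt (max 1 (2 * B / δ))
    have hK1 : (0 : ℝ) < K := lt_of_lt_of_le one_pos ((le_max_left _ _).trans hK.le)
    have hK2 : B / K ≤ δ / 2 := by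
      have := (le_max_right 1 (2 * B / δ)).trans hK.le
      rw [div_le_iff₀ hδ] at this
      rw [div_le_iff₀ hK1]; linarith
    have h1 := ih _ (IsSOS.mul hs (bern_sos i K)) (K * δ / 4) (by positivity)
    have h2 := hB i (2 * K)
    have h3 := ih s hs (K * δ / 4) (by positivity)
    have h4 := hsm (1 / K) _ (by positivity) (Cn.add_mem (Cn.add_mem h1 h2) h3)
    have h5 := Cn.add_mem h4 (hsos _ (IsSOS.const (c := δ / 2 - B / K) (by linarith)))
    convert h5 using 1
    have e1 : C (1 / (K : ℝ)) * (s * ((X i ^ 2) ^ K - 1 - C (K : ℝ) * (X i ^ 2 - 1)) * w + C (K * δ / 4) +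
      (C B - s * w * X i ^ (2 * K)) + (s * w + C (K * δ / 4))) =
      (C (1 / (K : ℝ)) * C (K : ℝ)) * (s * w * (1 - X i ^ 2)) + C (1 / (K : ℝ)) * (C (K * δ / 4) + C (K * δ / 4) + C B) := by
      rw [← pow_mul]; ring
    rw [e1, ← C_mul, ← C_add, ← C_add, ← C_mul]
    have e2 : 1 / (K : ℝ) * K = 1 := by field_simp
    have e3 : 1 / (K : ℝ) * (K * δ / 4 + K * δ / 4 + B) = δ / 2 + B / K := by field_simp; ring
    have e4 : δ = (δ / 2 + B / K) + (δ / 2 - B / K) := by ring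
    rw [e2, e3, C_1]
    conv_lhs => rw [e4]
    rw [C_add (a := δ / 2 + B / K)]; ring

theorem box [Fintype σ] {Cn : AddSubmonoid (MvPolynomial σ ℝ)} (hsos : ∀ p, IsSOS p → p ∈ Cn)
    (hsm : ∀ (c : ℝ) p, 0 ≤ c → p ∈ Cn → C c * p ∈ Cn) (hpow : ∀ i (r : ℕ), 1 - X i ^ (2 * r) ∈ Cn)
    (G : MvPolynomial σ ℝ) (hG : ∀ x : σ → ℝ, (∀ i, |x i| ≤ 1) → 0 < eval x G) : G ∈ Cn := by
  classical
  obtain ⟨c, hc, hGc⟩ : ∃ c : ℝ, 0 < c ∧ ∀ x : σ → ℝ, (∀ i, |x i| ≤ 1) → c < eval x G := by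
    have hcomp : IsCompact (Set.Icc (fun _ => -1) (fun _ => 1) : Set (σ → ℝ)) := isCompact_Icc
    obtain ⟨x0, hx0, hmin⟩ := hcomp.exists_isMinOn ⟨fun _ => 0, by constructor <;> intro i <;> norm_num⟩
      (MvPolynomial.continuous_eval G).continuousOn
    have h0 := hG x0 (fun i => abs_le.2 ⟨hx0.1 i, hx0.2 i⟩)
    refine ⟨eval x0 G / 2, by linarith, fun x hx => ?_⟩
    have := hmin (show x ∈ Set.Icc (fun _ => -1) (fun _ => 1) from ⟨fun i => (abs_le.1 (hx i)).1, fun i => (abs_le.1 (hx i)).2⟩)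
    simp only [Set.mem_ofPred_eq] at this
    linarith
  have hbox : ∀ x : σ → ℝ, (∀ j, 0 ≤ eval x ((1 : MvPolynomial σ ℝ) - X j ^ 2)) → ∀ i, |x i| ≤ 1 := by
    intro x hx i
    have := hx i
    simp at this
    exact this
  obtain ⟨d, hd, e⟩ := schmuedgen (fun j : σ => (1 : MvPolynomial σ ℝ) - X j ^ 2) (Fintype.card σ + 1) (fun x hx => by
      have : ∑ i, x i ^ 2 ≤ ∑ i : σ, (1 : ℝ) := Finset.sum_le_sum (fun i _ => (sq_le_one_iff_abs_le_one _).2 (hbox x hx i))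
      simp at this
      linarith) (G - C c) (fun x hx => by
      have := hGc x (hbox x hx)
      simp; linarith)
  have hpos : (0 : ℝ) < c / Fintype.card (Finset σ) := div_pos hc (by exact_mod_cast Fintype.card_pos)
  have h1 : ∑ J : Finset σ, (d J * ∏ j ∈ J, ((1 : MvPolynomial σ ℝ) - X j ^ 2) + C (c / Fintype.card (Finset σ))) ∈ Cn :=
    Cn.sum_mem (fun J _ => box_bar hsos hsm hpow J (d J) (hd J) _ hpos)
  rw [Finset.sum_add_distrib, ← e, ← map_sum] at h1
  have e2 : ∑ J : Finset σ, c / (Fintype.card (Finset σ) : ℝ) = c := by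
    rw [Finset.sum_const, Finset.card_univ, nsmul_eq_mul]
    have : (Fintype.card (Finset σ) : ℝ) ≠ 0 := by exact_mod_cast Fintype.card_ne_zero
    field_simp
  rw [e2] at h1
  simpa using h1
end
end CP

namespace CP

lemma pen_bd (t : ℝ) (k : ℕ) (hk : 0 < k) (ht : |t| ≤ 1) :
    t * (1 - t) ^ (2 * k) ≤ - max (-t) 0 + 1 / k := by
  have hk' : (0:ℝ) < k := by exact_mod_cast hk
  obtain ⟨h1, h2⟩ := abs_le.1 ht
  rcases le_or_gt 0 t with h0 | h0
  · rw [max_eq_right (by linarith)]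
    have hb : 1 + ((2 * k : ℕ) : ℝ) * t ≤ (1 + t) ^ (2 * k) :=
      one_add_mul_le_pow (by linarith) _
    have hp : 0 ≤ (1 - t) ^ (2 * k) := pow_nonneg (by linarith) _
    have h3 : (1 - t) ^ (2 * k) * (1 + t) ^ (2 * k) ≤ 1 := by
      rw [← mul_pow]; exact pow_le_one₀ (by nlinarith) (by nlinarith)
    have h4 := mul_le_mul_of_nonneg_left hb hp
    push_cast at h4
    have h5 : 0 ≤ (1 - t) ^ (2 * k) * (k * t) := by positivity
    rw [neg_zero, zero_add, le_div_iff₀ hk']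
    nlinarith
  · rw [max_eq_left (by linarith), neg_neg]
    have h3 : 1 ≤ (1 - t) ^ (2 * k) := one_le_pow₀ (by linarith)
    have : 0 < 1 / (k:ℝ) := by positivity
    nlinarith

lemma pen_exists {E ι : Type*} [TopologicalSpace E] [Fintype ι] {B : Set E} (hB : IsCompact B)
    (P : E → ℝ) (hP : Continuous P) (g : ι → E → ℝ) (hg : ∀ j, Continuous (g j))
    (hb : ∀ j, ∀ x ∈ B, |g j x| ≤ 1) (hpos : ∀ x ∈ B, (∀ j, 0 ≤ g j x) → 0 < P x) :
    ∃ (l : ℝ) (k : ℕ), 0 ≤ l ∧ ∀ x ∈ B, l * ∑ j, g j x * (1 - g j x) ^ (2 * k) < P x := by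
  obtain ⟨r, hr⟩ := hB.elim_directed_cover
    (fun r : ℕ => {x | 1 / ((r:ℝ) + 1) < P x + r * ∑ j, max (-(g j x)) 0})
    (fun r => isOpen_lt continuous_const (by fun_prop)) (by
      intro x hx
      rw [Set.mem_iUnion]
      have hs : 0 ≤ ∑ j, max (-(g j x)) 0 := Finset.sum_nonneg (fun j _ => le_max_right _ _)
      by_cases hc : ∀ j, 0 ≤ g j x
      · have := hpos x hx hc
        obtain ⟨r, hr⟩ := exists_nat_one_div_lt this
        refine ⟨r, ?_⟩
        change 1 / ((r:ℝ) + 1) < _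
        have : 0 ≤ (r:ℝ) * ∑ j, max (-(g j x)) 0 := by positivity
        linarith
      · push Not at hc
        obtain ⟨j, hj⟩ := hc
        have hs' : 0 < ∑ j, max (-(g j x)) 0 :=
          Finset.sum_pos' (fun j _ => le_max_right _ _) ⟨j, Finset.mem_univ _, lt_max_of_lt_left (by linarith)⟩
        obtain ⟨r, hr⟩ := exists_nat_gt ((1 - P x) / ∑ j, max (-(g j x)) 0)
        refine ⟨r, ?_⟩
        change 1 / ((r:ℝ) + 1) < _
        rw [div_lt_iff₀ hs'] at hr
        have : 1 / ((r:ℝ) + 1) ≤ 1 := by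
          rw [div_le_one (by positivity)]; linarith [(Nat.cast_nonneg r : (0:ℝ) ≤ r)]
        linarith) (by
      refine directed_of_isDirected_le (fun r s hrs x hx => ?_)
      change 1 / ((r:ℝ) + 1) < _ at hx
      change 1 / ((s:ℝ) + 1) < _
      have hs : 0 ≤ ∑ j, max (-(g j x)) 0 := Finset.sum_nonneg (fun j _ => le_max_right _ _)
      have h1 : (r:ℝ) ≤ s := by exact_mod_cast hrs
      have h2 : 1 / ((s:ℝ) + 1) ≤ 1 / ((r:ℝ) + 1) := one_div_le_one_div_of_le (by positivity) (by linarith)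
      nlinarith)
  obtain ⟨k, hk⟩ := exists_nat_gt ((r:ℝ) * Fintype.card ι * (r + 1))
  have hk0 : 0 < k := by
    have : (0:ℝ) < k := lt_of_le_of_lt (by positivity) hk
    exact_mod_cast this
  have hk0' : (0:ℝ) < k := by exact_mod_cast hk0
  refine ⟨r, k, by positivity, fun x hx => ?_⟩
  have h1 := hr hx
  change 1 / ((r:ℝ) + 1) < _ at h1
  have h2 : ∑ j, g j x * (1 - g j x) ^ (2 * k) ≤ ∑ j, (- max (-(g j x)) 0 + 1 / (k:ℝ)) :=
    Finset.sum_le_sum (fun j _ => pen_bd _ k hk0 (hb j x hx))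
  rw [Finset.sum_add_distrib, Finset.sum_neg_distrib, Finset.sum_const, Finset.card_univ, nsmul_eq_mul] at h2
  have h3 := mul_le_mul_of_nonneg_left h2 (Nat.cast_nonneg r : (0:ℝ) ≤ r)
  have h4 : (r:ℝ) * (Fintype.card ι * (1 / k)) ≤ 1 / (r + 1) := by
    rw [le_div_iff₀ (by positivity)]
    have : (r:ℝ) * (Fintype.card ι * (1 / k)) * (r + 1) = ((r:ℝ) * Fintype.card ι * (r + 1)) / k := by ring
    rw [this, div_le_one hk0']; exact hk.le
  nlinarith

lemma sw {m : ℕ} {B : Set (Fin m → ℝ)} (hB : IsCompact B) (F : (Fin m → ℝ) → ℝ) (hF : Continuous F)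
    (ε : ℝ) (hε : 0 < ε) : ∃ q : MvPolynomial (Fin m) ℝ, ∀ y ∈ B, |eval y q - F y| < ε := by
  haveI : CompactSpace B := isCompact_iff_compactSpace.1 hB
  let co : Fin m → C(B, ℝ) := fun i => ⟨fun y => y.1 i, (continuous_apply i).comp continuous_subtype_val⟩
  let A : Subalgebra ℝ C(B, ℝ) := (aeval co : MvPolynomial (Fin m) ℝ →ₐ[ℝ] C(B, ℝ)).range
  have hsep : A.SeparatesPoints := by
    intro y z hyz
    have : ∃ i, y.1 i ≠ z.1 i := by
      by_contra hc; push Not at hc; exact hyz (Subtype.ext (funext hc))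
    obtain ⟨i, hi⟩ := this
    exact ⟨co i, ⟨co i, ⟨X i, by simp⟩, rfl⟩, hi⟩
  obtain ⟨⟨_, q, rfl⟩, hq⟩ := ContinuousMap.exists_mem_subalgebra_near_continuousMap_of_separatesPoints A hsep
    ⟨fun y : B => F y.1, by fun_prop⟩ ε hε
  refine ⟨q, fun y hy => ?_⟩
  have h1 := lt_of_le_of_lt (ContinuousMap.norm_coe_le_norm _ (⟨y, hy⟩ : B)) hq
  rw [Real.norm_eq_abs] at h1
  have h2 : ((aeval co : MvPolynomial (Fin m) ℝ →ₐ[ℝ] C(B, ℝ)) q) ⟨y, hy⟩ = eval y q := by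
    have : (ContinuousMap.evalAlgHom ℝ ℝ (⟨y, hy⟩ : B)).comp (aeval co) = aeval y := by
      ext i; simp [co]
    have := DFunLike.congr_fun this q
    simpa [aeval_eq_eval] using this
  simpa [h2] using h1

section qm
variable {σ κ : Type*} [Fintype κ] {g : κ → MvPolynomial σ ℝ}

lemma qm_add {p q : MvPolynomial σ ℝ} (hp : InQuadraticModule g p) (hq : InQuadraticModule g q) :
    InQuadraticModule g (p + q) := by
  obtain ⟨c0, c, h0, h1, rfl⟩ := hp
  obtain ⟨d0, d, h2, h3, rfl⟩ := hq
  refine ⟨c0 + d0, fun j => c j + d j, IsSOS.add h0 h2, fun j => IsSOS.add (h1 j) (h3 j), ?_⟩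
  simp_rw [add_mul, Finset.sum_add_distrib]; ring

lemma qm_sos {p : MvPolynomial σ ℝ} (hp : IsSOS p) : InQuadraticModule g p :=
  ⟨p, fun _ => 0, hp, fun _ => IsSOS.zero, by simp⟩

lemma qm_lin {c : κ → MvPolynomial σ ℝ} (hc : ∀ j, IsSOS (c j)) : InQuadraticModule g (∑ j, c j * g j) :=
  ⟨0, c, IsSOS.zero, hc, by simp⟩

lemma qm_mul {p s : MvPolynomial σ ℝ} (hs : IsSOS s) (hp : InQuadraticModule g p) :
    InQuadraticModule g (s * p) := by
  obtain ⟨c0, c, h0, h1, rfl⟩ := hp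
  refine ⟨s * c0, fun j => s * c j, IsSOS.mul hs h0, fun j => IsSOS.mul hs (h1 j), ?_⟩
  rw [mul_add, Finset.mul_sum]; simp_rw [mul_assoc]

lemma IsSOS.map {τ : Type*} (φ : MvPolynomial σ ℝ →ₐ[ℝ] MvPolynomial τ ℝ) {p : MvPolynomial σ ℝ} (hp : IsSOS p) :
    IsSOS (φ p) := by
  obtain ⟨k, s, rfl⟩ := hp
  exact ⟨k, fun i => φ (s i), by simp⟩

lemma qm_pow [Fintype σ] {N R : ℝ} (hR : N ≤ R ^ 2) (hN : InQuadraticModule g (C N - ∑ i, X i ^ 2)) (i : σ) (r : ℕ) :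
    InQuadraticModule g (C (R ^ 2) ^ r - (X i ^ 2) ^ r) := by
  classical
  have h1 : InQuadraticModule g (C (R ^ 2) - X i ^ 2) := by
    have h2 : IsSOS (∑ j ∈ Finset.univ.erase i, (X j : MvPolynomial σ ℝ) ^ 2) := IsSOS.sum (fun j _ => IsSOS.sq _)
    have h3 : IsSOS (C (R ^ 2 - N) : MvPolynomial σ ℝ) := IsSOS.const (by linarith)
    convert qm_add hN (qm_sos (IsSOS.add h2 h3)) using 1
    rw [← Finset.add_sum_erase _ _ (Finset.mem_univ i), C_sub]; ring
  rw [← Commute.geom_sum₂_mul (Commute.all _ _)]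
  refine qm_mul (IsSOS.sum (fun j _ => ?_)) h1
  rw [C_pow, ← pow_mul, ← pow_mul, mul_comm 2, mul_comm 2, pow_mul, pow_mul]
  exact IsSOS.mul (IsSOS.sq _) (IsSOS.sq _)

end qm

lemma scale_comp {σ : Type*} (R : ℝ) (hR : R ≠ 0) (G : MvPolynomial σ ℝ) :
    (aeval (fun i => C R⁻¹ * X i) : MvPolynomial σ ℝ →ₐ[ℝ] MvPolynomial σ ℝ)
      ((aeval (fun i => C R * X i) : MvPolynomial σ ℝ →ₐ[ℝ] MvPolynomial σ ℝ) G) = G := by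
  have : (aeval (fun i => C R⁻¹ * X i) : MvPolynomial σ ℝ →ₐ[ℝ] MvPolynomial σ ℝ).comp
      (aeval (fun i => C R * X i) : MvPolynomial σ ℝ →ₐ[ℝ] MvPolynomial σ ℝ) = AlgHom.id ℝ _ := by
    ext1 i
    simp only [AlgHom.comp_apply, aeval_X, map_mul, AlgHom.id_apply]
    rw [← algebraMap_eq, AlgHom.commutes, algebraMap_eq, ← mul_assoc, ← C_mul, mul_inv_cancel₀ hR]; simp
  exact DFunLike.congr_fun this G

lemma scale_eval {σ : Type*} (R : ℝ) (x : σ → ℝ) (G : MvPolynomial σ ℝ) :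
    eval x ((aeval (fun i => C R * X i) : MvPolynomial σ ℝ →ₐ[ℝ] MvPolynomial σ ℝ) G) = eval (fun i => R * x i) G := by
  rw [← aeval_eq_eval, ← aeval_eq_eval]
  have : (aeval x).comp (aeval (fun i => C R * X i) : MvPolynomial σ ℝ →ₐ[ℝ] MvPolynomial σ ℝ)
     = (aeval (fun i => R * x i) : MvPolynomial σ ℝ →ₐ[ℝ] ℝ) := by
    ext1 i; simp
  exact DFunLike.congr_fun this G

/-- The mixed cone. -/
def mixed {n m a : ℕ} (g : Fin a → MvPolynomial (Fin n) ℝ) (B : Set (Fin m → ℝ)) :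
    AddSubmonoid (MvPolynomial (Fin n ⊕ Fin m) ℝ) where
  carrier := {p | ∃ κ s ψ, IsSOS κ ∧ InQuadraticModule g s ∧ (∀ y ∈ B, 0 ≤ eval y ψ) ∧
    p = κ + rename Sum.inl s + rename Sum.inr ψ}
  zero_mem' := ⟨0, 0, 0, IsSOS.zero, qm_sos IsSOS.zero, by simp, by simp⟩
  add_mem' := by
    rintro _ _ ⟨κ, s, ψ, h1, h2, h3, rfl⟩ ⟨κ', s', ψ', h1', h2', h3', rfl⟩
    refine ⟨κ + κ', s + s', ψ + ψ', IsSOS.add h1 h1', qm_add h2 h2', fun y hy => ?_, ?_⟩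
    · rw [map_add]; exact add_nonneg (h3 y hy) (h3' y hy)
    · simp only [map_add]; ring

lemma mixed_box {n m a : ℕ} (g : Fin a → MvPolynomial (Fin n) ℝ) {N R : ℝ} (hR0 : 0 < R) (hR : N ≤ R ^ 2)
    (hN : InQuadraticModule g (C N - ∑ i, X i ^ 2)) (G : MvPolynomial (Fin n ⊕ Fin m) ℝ)
    (hG : ∀ x : Fin n ⊕ Fin m → ℝ, (∀ i, |x i| ≤ R) → 0 < eval x G) :
    G ∈ mixed g {y : Fin m → ℝ | ∀ j, |y j| ≤ R} := by
  have key : (aeval (fun i => C R * X i) : MvPolynomial (Fin n ⊕ Fin m) ℝ →ₐ[ℝ] MvPolynomial (Fin n ⊕ Fin m) ℝ) G ∈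
      (mixed g {y : Fin m → ℝ | ∀ j, |y j| ≤ R}).comap
        (aeval (fun i => C R⁻¹ * X i) : MvPolynomial (Fin n ⊕ Fin m) ℝ →ₐ[ℝ] MvPolynomial (Fin n ⊕ Fin m) ℝ) := by
    refine box ?_ ?_ ?_ _ ?_
    · intro p hp
      exact ⟨_, 0, 0, IsSOS.map _ hp, qm_sos IsSOS.zero, by simp, by rw [map_zero, map_zero, add_zero, add_zero]⟩
    · rintro c p hc ⟨κ, s, ψ, h1, h2, h3, h4⟩
      refine ⟨C c * κ, C c * s, C c * ψ, IsSOS.mul (IsSOS.const hc) h1, qm_mul (IsSOS.const hc) h2, fun y hy => ?_, ?_⟩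
      · rw [map_mul, eval_C]; exact mul_nonneg hc (h3 y hy)
      · change aeval _ (C c * p) = _
        change aeval _ p = _ at h4
        rw [map_mul, h4, ← algebraMap_eq, AlgHom.commutes]
        simp only [map_mul, algebraMap_eq, rename_C]; ring
    · have e1 : ∀ (i : Fin n ⊕ Fin m) (r : ℕ), (aeval (fun i => C R⁻¹ * X i) : MvPolynomial (Fin n ⊕ Fin m) ℝ →ₐ[ℝ] MvPolynomial (Fin n ⊕ Fin m) ℝ) (1 - X i ^ (2 * r)) = 1 - C (R⁻¹ ^ (2 * r)) * X i ^ (2 * r) := by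
        intro i r
        simp only [map_sub, map_one, map_pow, aeval_X, mul_pow, C_pow]
      rintro (i | j) r
      · refine ⟨0, C (R⁻¹ ^ (2 * r)) * (C (R ^ 2) ^ r - (X i ^ 2) ^ r), 0, IsSOS.zero,
          qm_mul (IsSOS.const (by positivity)) (qm_pow hR hN i r), by simp, ?_⟩
        refine (e1 _ r).trans ?_
        rw [mul_sub, ← C_pow, ← C_mul, ← pow_mul, ← pow_mul, ← mul_pow, inv_mul_cancel₀ hR0.ne']
        simp
      · refine ⟨0, 0, 1 - C (R⁻¹ ^ (2 * r)) * X j ^ (2 * r), IsSOS.zero, qm_sos IsSOS.zero, fun y hy => ?_, ?_⟩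
        · have h1 : |y j| ≤ R := hy j
          have h2 : (R⁻¹ * y j) ^ (2 * r) ≤ 1 := by
            rw [pow_mul]
            refine pow_le_one₀ (by positivity) ?_
            rw [sq_le_one_iff_abs_le_one, abs_mul, abs_of_pos (inv_pos.2 hR0), inv_mul_le_one₀ hR0]
            exact h1
          simp only [map_sub, map_one, map_mul, eval_C, map_pow, eval_X]
          rw [mul_pow] at h2
          linarith
        · refine (e1 _ r).trans ?_
          simp
    · intro x hx
      rw [scale_eval]
      refine hG _ (fun i => ?_)
      rw [abs_mul, abs_of_pos hR0]
      nlinarith [hx i]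
  have := AddSubmonoid.mem_comap.1 key
  rwa [scale_comp R hR0.ne'] at this

end CP

namespace CP

lemma box_compact {σ : Type} [Fintype σ] (R : ℝ) : IsCompact {x : σ → ℝ | ∀ i, |x i| ≤ R} := by
  have : {x : σ → ℝ | ∀ i, |x i| ≤ R} = Set.Icc (fun _ => -R) (fun _ => R) := by
    ext x
    constructor
    · intro hx; exact ⟨fun i => (abs_le.1 (hx i)).1, fun i => (abs_le.1 (hx i)).2⟩
    · intro hx i; exact abs_le.2 ⟨hx.1 i, hx.2 i⟩
  rw [this]; exact isCompact_Icc

lemma cont_sInf {α β : Type*} [TopologicalSpace α] [TopologicalSpace β] (f : α → β → ℝ) {K : Set β}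
    (hK : IsCompact K) (hf : Continuous (fun z : α × β => f z.1 z.2)) :
    Continuous (fun y => sInf ((fun x => f y x) '' K)) :=
  IsCompact.continuous_sInf hK hf

/-- A separating polynomial in the shared variables. -/
lemma exists_q {n m p : ℕ} {Kx : Set (Fin n → ℝ)} {Kyz : Set ((Fin m → ℝ) × (Fin p → ℝ))}
    (hKx : IsCompact Kx) (hKyz : IsCompact Kyz) (hx0 : Kx.Nonempty) (hyz0 : Kyz.Nonempty)
    {B : Set (Fin m → ℝ)} (hB : IsCompact B) (hKB : ∀ w ∈ Kyz, w.1 ∈ B)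
    (f₁ : MvPolynomial (Fin n ⊕ Fin m) ℝ) (f₂ : MvPolynomial (Fin m ⊕ Fin p) ℝ)
    (hpos : ∀ x ∈ Kx, ∀ w ∈ Kyz, 0 < eval (Sum.elim x w.1) f₁ + eval (Sum.elim w.1 w.2) f₂) :
    ∃ q : MvPolynomial (Fin m) ℝ, (∀ x ∈ Kx, ∀ y ∈ B, 0 < eval (Sum.elim x y) f₁ - eval y q) ∧
      ∀ w ∈ Kyz, 0 < eval w.1 q + eval (Sum.elim w.1 w.2) f₂ := by
  have hc1 : Continuous (fun z : (Fin m → ℝ) × (Fin n → ℝ) => eval (Sum.elim z.2 z.1) f₁) := by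
    refine (MvPolynomial.continuous_eval f₁).comp (continuous_pi ?_)
    rintro (i | i)
    · exact (continuous_apply i).comp continuous_snd
    · exact (continuous_apply i).comp continuous_fst
  have hc2 : Continuous (fun w : (Fin m → ℝ) × (Fin p → ℝ) => eval (Sum.elim w.1 w.2) f₂) := by
    refine (MvPolynomial.continuous_eval f₂).comp (continuous_pi ?_)
    rintro (i | i)
    · exact (continuous_apply i).comp continuous_fst
    · exact (continuous_apply i).comp continuous_snd
  have hF : Continuous (fun y : Fin m → ℝ => sInf ((fun x => eval (Sum.elim x y) f₁) '' Kx)) :=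
    by
      have := cont_sInf (fun (y : Fin m → ℝ) (x : Fin n → ℝ) => eval (Sum.elim x y) f₁) hKx
      have := this hc1
      exact this
  have hcy : ∀ y : Fin m → ℝ, Continuous (fun x : Fin n → ℝ => eval (Sum.elim x y) f₁) := by
    intro y
    refine (MvPolynomial.continuous_eval f₁).comp (continuous_pi ?_)
    rintro (i | i)
    · exact continuous_apply i
    · exact continuous_const
  have hFle : ∀ y, ∀ x ∈ Kx, sInf ((fun x => eval (Sum.elim x y) f₁) '' Kx) ≤ eval (Sum.elim x y) f₁ := by
    intro y x hx
    exact csInf_le (hKx.image (hcy y)).bddBelow ⟨x, hx, rfl⟩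
  obtain ⟨w0, hw0, hmin⟩ := hKyz.exists_isMinOn hyz0 ((hF.comp continuous_fst).add hc2).continuousOn
  have hpos0 : 0 < sInf ((fun x => eval (Sum.elim x w0.1) f₁) '' Kx) + eval (Sum.elim w0.1 w0.2) f₂ := by
    obtain ⟨x, hx, hxe⟩ := (hKx.image (hcy w0.1)).sInf_mem (hx0.image _)
    have := hpos x hx w0 hw0
    simp only at hxe
    linarith
  set e := sInf ((fun x => eval (Sum.elim x w0.1) f₁) '' Kx) + eval (Sum.elim w0.1 w0.2) f₂ with he
  obtain ⟨q, hq⟩ := sw hB (fun y => sInf ((fun x => eval (Sum.elim x y) f₁) '' Kx) - e / 2)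
    (hF.sub continuous_const) (e / 4) (by linarith)
  refine ⟨q, fun x hx y hy => ?_, fun w hw => ?_⟩
  · have h1 := abs_lt.1 (hq y hy)
    have h2 := hFle y x hx
    linarith [h1.2]
  · have h1 := abs_lt.1 (hq w.1 (hKB w hw))
    have h2 : e ≤ sInf ((fun x => eval (Sum.elim x w.1) f₁) '' Kx) + eval (Sum.elim w.1 w.2) f₂ := hmin hw
    linarith [h1.1]

theorem main
    (n m p a b : ℕ)
    (g : Fin a → MvPolynomial (Fin n) ℝ)
    (h : Fin b → MvPolynomial (Fin m ⊕ Fin p) ℝ)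
    (Kx : Set (Fin n → ℝ))
    (Kyz : Set ((Fin m → ℝ) × (Fin p → ℝ)))
    (hKx : Kx = {x | ∀ j, 0 ≤ eval x (g j)})
    (hKyz : Kyz = {w | ∀ k, 0 ≤ eval (Sum.elim w.1 w.2) (h k)})
    (hKxCompact : IsCompact Kx) (hKyzCompact : IsCompact Kyz)
    (hx0 : Kx.Nonempty) (hyz0 : Kyz.Nonempty)
    (N : ℝ)
    (hN : InQuadraticModule g (C N - ∑ i : Fin n, X i ^ 2))
    (f₁ : MvPolynomial (Fin n ⊕ Fin m) ℝ) (f₂ : MvPolynomial (Fin m ⊕ Fin p) ℝ)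
    (hpos : ∀ x ∈ Kx, ∀ w ∈ Kyz, 0 < eval (Sum.elim x w.1) f₁ + eval (Sum.elim w.1 w.2) f₂) :
    ∃ (κpol : MvPolynomial (Fin n ⊕ Fin m) ℝ) (σ : MvPolynomial (Fin n) ℝ)
      (ψ : MvPolynomial (Fin m ⊕ Fin p) ℝ),
      IsSOS κpol ∧ InQuadraticModule g σ ∧ InPreordering h ψ ∧
      rename (Sum.map id Sum.inl) f₁ + rename Sum.inr f₂ =
      (rename (Sum.map id Sum.inl) κpol + rename Sum.inl σ + rename Sum.inr ψ :
        MvPolynomial (Fin n ⊕ Fin m ⊕ Fin p) ℝ) := by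
  obtain ⟨R1, hR1⟩ := hKyzCompact.isBounded.exists_norm_le
  obtain ⟨R, hR0, hRN, hRw⟩ : ∃ R : ℝ, 0 < R ∧ N ≤ R ^ 2 ∧ ∀ w ∈ Kyz, ‖w‖ ≤ R := by
    refine ⟨max 1 (max N R1), lt_max_of_lt_left one_pos, ?_, fun w hw => (hR1 w hw).trans ?_⟩
    · have h1 : 1 ≤ max 1 (max N R1) := le_max_left _ _
      have h2 : N ≤ max 1 (max N R1) := (le_max_left _ _).trans (le_max_right _ _)
      nlinarith
    · exact (le_max_right _ _).trans (le_max_right _ _)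
  have hy : ∀ w ∈ Kyz, ∀ j, |w.1 j| ≤ R := fun w hw j =>
    (norm_le_pi_norm w.1 j).trans ((norm_fst_le w).trans (hRw w hw))
  have hz : ∀ w ∈ Kyz, ∀ j, |w.2 j| ≤ R := fun w hw j =>
    (norm_le_pi_norm w.2 j).trans ((norm_snd_le w).trans (hRw w hw))
  obtain ⟨q, hq1, hq2⟩ := exists_q hKxCompact hKyzCompact hx0 hyz0
    (box_compact (σ := Fin m) R) hy f₁ f₂ hpos
  have hcg : ∀ j, Continuous (fun x : Fin n ⊕ Fin m → ℝ => eval (fun i => x (Sum.inl i)) (g j)) := fun j =>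
    (MvPolynomial.continuous_eval (g j)).comp (continuous_pi (fun i => continuous_apply _))
  have hM : ∀ j, ∃ c : ℝ, 0 < c ∧ ∀ x ∈ {x : Fin n ⊕ Fin m → ℝ | ∀ i, |x i| ≤ R},
      |c * eval (fun i => x (Sum.inl i)) (g j)| ≤ 1 := by
    intro j
    obtain ⟨M, hM⟩ := (box_compact (σ := Fin n ⊕ Fin m) R).exists_bound_of_continuousOn (hcg j).continuousOn
    have hM0 : 0 < |M| + 1 := by positivity
    refine ⟨(|M| + 1)⁻¹, by positivity, fun x hx => ?_⟩
    rw [abs_mul, abs_of_pos (inv_pos.2 hM0), inv_mul_le_one₀ hM0]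
    have := hM x hx
    rw [Real.norm_eq_abs] at this
    linarith [le_abs_self M]
  choose c hc0 hc1 using hM
  obtain ⟨l, k, hl, hlk⟩ := pen_exists (box_compact (σ := Fin n ⊕ Fin m) R)
    (fun x => eval x (f₁ - rename Sum.inr q)) (MvPolynomial.continuous_eval _)
    (fun j x => c j * eval (fun i => x (Sum.inl i)) (g j)) (fun j => continuous_const.mul (hcg j))
    hc1 (by
      intro x hx hxg
      have hxK : (fun i => x (Sum.inl i)) ∈ Kx := by
        rw [hKx]
        intro j
        exact (mul_nonneg_iff_of_pos_left (hc0 j)).1 (hxg j)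
      have := hq1 _ hxK (fun i => x (Sum.inr i)) (fun i => hx _)
      have e : Sum.elim (fun i => x (Sum.inl i)) (fun i => x (Sum.inr i)) = x := by
        ext (i | i) <;> rfl
      rw [e] at this
      simp only [map_sub, eval_rename]
      exact this)
  let s : MvPolynomial (Fin n) ℝ := ∑ j, (C (l * c j) * ((1 - C (c j) * g j) ^ k) ^ 2) * g j
  have hs : InQuadraticModule g s :=
    qm_lin (fun j => IsSOS.mul (IsSOS.const (mul_nonneg hl (hc0 j).le)) (IsSOS.sq _))
  obtain ⟨κ, σ, ψ, h1, h2, h3, h4⟩ := mixed_box (m := m) g hR0 hRN hN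
    (f₁ - rename Sum.inr q - rename Sum.inl s) (by
      intro x hx
      have := hlk x hx
      rw [map_sub, sub_pos]
      refine lt_of_eq_of_lt ?_ this
      rw [eval_rename]
      simp only [s, map_sum, map_mul, eval_C, map_pow, map_sub, map_one, Finset.mul_sum]
      refine Finset.sum_congr rfl (fun j _ => ?_)
      rw [← pow_mul, mul_comm k 2]
      simp only [Function.comp_def]
      ring)
  refine ⟨κ, σ + s, rename Sum.inl ψ + rename Sum.inl q + f₂, h1, qm_add h2 hs, ?_, ?_⟩
  · have hmem : ∀ x : Fin m ⊕ Fin p → ℝ, (∀ j, 0 ≤ eval x (h j)) →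
        ((fun i => x (Sum.inl i), fun i => x (Sum.inr i)) : (Fin m → ℝ) × (Fin p → ℝ)) ∈ Kyz ∧
        Sum.elim (fun i => x (Sum.inl i)) (fun i => x (Sum.inr i)) = x := by
      intro x hx
      have e : Sum.elim (fun i => x (Sum.inl i)) (fun i => x (Sum.inr i)) = x := by
        ext (i | i) <;> rfl
      refine ⟨?_, e⟩
      rw [hKyz]
      intro j
      change 0 ≤ eval (Sum.elim (fun i => x (Sum.inl i)) (fun i => x (Sum.inr i))) (h j)
      rw [e]; exact hx j
    refine schmuedgen h ((∑ _i : Fin m ⊕ Fin p, R ^ 2) + 1) (fun x hx => ?_) _ (fun x hx => ?_)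
    · obtain ⟨hm, _⟩ := hmem x hx
      refine lt_of_le_of_lt (Finset.sum_le_sum (fun i _ => ?_)) (lt_add_one _)
      rw [← sq_abs]
      refine pow_le_pow_left₀ (abs_nonneg _) ?_ 2
      rcases i with i | i
      · exact hy _ hm i
      · exact hz _ hm i
    · obtain ⟨hm, e⟩ := hmem x hx
      have h5 := hq2 _ hm
      have h6 := h3 _ (hy _ hm)
      simp only [e] at h5
      simp only [map_add, eval_rename, Function.comp_def]
      simp only at h6
      linarith
  · have h5 : f₁ = κ + rename Sum.inl σ + rename Sum.inr ψ + rename Sum.inr q + rename Sum.inl s := by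
      rw [← h4]; ring
    have e1 : (Sum.map id Sum.inl : Fin n ⊕ Fin m → Fin n ⊕ Fin m ⊕ Fin p) ∘ Sum.inl = Sum.inl := rfl
    have e2 : (Sum.map id Sum.inl : Fin n ⊕ Fin m → Fin n ⊕ Fin m ⊕ Fin p) ∘ Sum.inr = Sum.inr ∘ Sum.inl := rfl
    rw [h5]
    simp only [map_add, rename_rename, e1, e2]
    ring

end CP

theorem cartesian_putinar_left
    (n m p a b : ℕ)
    (g : Fin a → MvPolynomial (Fin n) ℝ)
    (h : Fin b → MvPolynomial (Fin m ⊕ Fin p) ℝ)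
    (Kx : Set (Fin n → ℝ))
    (Kyz : Set ((Fin m → ℝ) × (Fin p → ℝ)))
    (K : Set ((Fin n → ℝ) × (Fin m → ℝ) × (Fin p → ℝ)))
    (hKx : Kx = {x | ∀ j, 0 ≤ eval x (g j)})
    (hKyz : Kyz = {w | ∀ k, 0 ≤ eval (Sum.elim w.1 w.2) (h k)})
    (hK : K = {w | w.1 ∈ Kx ∧ w.2 ∈ Kyz})
    (hKxCompact : IsCompact Kx) (hKyzCompact : IsCompact Kyz)
    (hKint : (interior K).Nonempty)
    (N : ℝ)
    (hN : InQuadraticModule g (C N - ∑ i : Fin n, X i ^ 2))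
    (f : MvPolynomial (Fin n ⊕ Fin m ⊕ Fin p) ℝ)
    (f₁ : MvPolynomial (Fin n ⊕ Fin m) ℝ) (f₂ : MvPolynomial (Fin m ⊕ Fin p) ℝ)
    (hf : f = rename (Sum.map id Sum.inl) f₁ + rename Sum.inr f₂)
    (hpos : ∀ w ∈ K, 0 < eval (Sum.elim w.1 (Sum.elim w.2.1 w.2.2)) f) :
    ∃ (κpol : MvPolynomial (Fin n ⊕ Fin m) ℝ) (σ : MvPolynomial (Fin n) ℝ)
      (ψ : MvPolynomial (Fin m ⊕ Fin p) ℝ),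
      IsSOS κpol ∧ InQuadraticModule g σ ∧ InPreordering h ψ ∧
      f = rename (Sum.map id Sum.inl) κpol + rename Sum.inl σ + rename Sum.inr ψ := by
  obtain ⟨w0, hw0⟩ := hKint
  have hw1 := interior_subset hw0
  rw [hK] at hw1
  rw [hf]
  refine CP.main n m p a b g h Kx Kyz hKx hKyz hKxCompact hKyzCompact ⟨_, hw1.1⟩ ⟨_, hw1.2⟩ N hN f₁ f₂ ?_
  intro x hx w hw
  have h1 := hpos (x, w) (by rw [hK]; exact ⟨hx, hw⟩)
  rw [hf, map_add, eval_rename, eval_rename] at h1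
  have e1 : (Sum.elim x (Sum.elim w.1 w.2) : Fin n ⊕ Fin m ⊕ Fin p → ℝ) ∘ Sum.map id Sum.inl = Sum.elim x w.1 := by
    ext (i | i) <;> rfl
  have e2 : (Sum.elim x (Sum.elim w.1 w.2) : Fin n ⊕ Fin m ⊕ Fin p → ℝ) ∘ Sum.inr = Sum.elim w.1 w.2 := by
    ext (i | i) <;> rfl
  simp only [e1, e2] at h1
  exact h1
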